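/- Let q be a power of a prime and F_q the finite field with q elements. Let A ⊆ F_q with |A| ≥ 2 and let δ > 0. Suppose there is a constant C > 0 such that for every proper subfield G of F_q and all elements c, d ∈ F_q one has |A ∩ (cG + d)| ≤ C·max{|G|^{1/2}, |A|^{1-δ}}. Then there is a constant C' > 0 depending only on C and δ such that T(A) ≤ C'·log|A|·max{|A + A|^{7/4}|A|^{3}, |A + A|^{6/5}|A|^{18/5}, |A|^{5 - δ/2}, |A + A|^{7/4}|A|^{7/2}q^{-1/4}}, and the same estimate holds with the sum set A + A replaced by the difference set A − A. -/

import Mathlib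

open scoped Classical Pointwise

noncomputable section

namespace STP

variable {F : Type} [Field F]

def collinearTriples (A B : Finset F) : ℕ :=
  (((A ×ˢ A ×ˢ A) ×ˢ (B ×ˢ B ×ˢ B)).filter fun x =>
    (x.1.2.1 - x.1.1) * (x.2.2.2 - x.2.1) = (x.1.2.2 - x.1.1) * (x.2.2.1 - x.2.1)).card

def IsLine (l : Set (F × F)) : Prop :=
  ∃ a b c : F, (a, b) ≠ (0, 0) ∧ l = {p : F × F | a * p.1 + b * p.2 = c}

def incidences (P : Finset (F × F)) (L : Finset (Set (F × F))) : ℕ :=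
  ((P ×ˢ L).filter fun x => x.1 ∈ x.2).card

def kIncidences (P : Finset (F × F)) (L : Finset (Set (F × F))) (k : ℕ) : ℕ :=
  (((Fintype.piFinset fun _ : Fin k => P) ×ˢ L).filter fun x => ∀ i, x.1 i ∈ x.2).card

def numLines (P : Finset (F × F)) : ℕ :=
  Set.ncard {l : Set (F × F) | IsLine l ∧ 2 ≤ (P.filter (· ∈ l)).card}

def addEnergy (X Y : Finset F) : ℕ :=
  (((X ×ˢ X) ×ˢ (Y ×ˢ Y)).filter fun t => t.1.1 + t.2.1 = t.1.2 + t.2.2).card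

def mulEnergy (A : Finset F) : ℕ :=
  (((A ×ˢ A) ×ˢ (A ×ˢ A)).filter fun t => t.1.1 * t.2.1 = t.1.2 * t.2.2).card

def quotSet (X : Finset F) : Set F :=
  {r : F | ∃ x1 ∈ X, ∃ x2 ∈ X, ∃ x3 ∈ X, ∃ x4 ∈ X, x3 ≠ x4 ∧ r = (x1 - x2) / (x3 - x4)}

def subfieldCond (A : Finset F) (C bound : ℝ) : Prop :=
  ∀ G : Subfield F, G ≠ ⊤ → ∀ c d : F,
    ((A.filter fun x => ∃ g ∈ G, x = c * g + d).card : ℝ) ≤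
      C * max ((Nat.card G : ℝ) ^ ((1:ℝ)/2)) bound

def linesOf [Fintype F] (P : Finset (F × F)) : Finset (Set (F × F)) :=
  Set.Finite.toFinset (Set.toFinite {l : Set (F × F) | IsLine l ∧ 2 ≤ (P.filter (· ∈ l)).card})

def tripleCount [Fintype F] (P : Finset (F × F)) : ℕ :=
  ∑ l ∈ linesOf P, ((P.filter (· ∈ l)).card) ^ 3


/-- Cauchy-Schwarz for the image of a map. -/
lemma cs_image {α β : Type*} (W : Finset α) (f : α → β) :
    W.card ^ 2 ≤ (W.image f).card * ((W ×ˢ W).filter fun p => f p.1 = f p.2).card := by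
  have h1 : W.card = ∑ b ∈ W.image f, (W.filter fun w => f w = b).card :=
    Finset.card_eq_sum_card_image f W
  have h2 : ((W ×ˢ W).filter fun p => f p.1 = f p.2).card
      = ∑ b ∈ W.image f, (W.filter fun w => f w = b).card ^ 2 := by
    rw [Finset.card_eq_sum_card_fiberwise (f := fun p : α × α => f p.1) (t := W.image f)]
    · refine Finset.sum_congr rfl fun b _ => ?_
      rw [sq, ← Finset.card_product]
      congr 1
      ext ⟨x, y⟩
      simp only [Finset.mem_filter, Finset.mem_product]
      constructor
      · rintro ⟨⟨⟨h1, h2⟩, h3⟩, h4⟩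
        exact ⟨⟨h1, h4⟩, h2, h3 ▸ h4⟩
      · rintro ⟨⟨h1, h4⟩, h2, h3⟩
        exact ⟨⟨⟨h1, h2⟩, h4.trans h3.symm⟩, h4⟩
    · intro p hp
      simp only [Finset.coe_filter, Finset.mem_product, Set.mem_ofPred_eq] at hp
      exact Finset.mem_coe.2 (Finset.mem_image_of_mem f hp.1.1)
  rw [h2]
  conv_lhs => rw [h1]
  exact sq_sum_le_card_mul_sum_sq

lemma exists_translate (U V : Finset F) (hU : U.Nonempty) (hV : V.Nonempty) (S : ℝ)
    (h : ((U + V).card : ℝ) ≤ S ∨ ((U - V).card : ℝ) ≤ S) :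
    ∃ t : F, (U.card : ℝ) * V.card ≤ S * ((U.filter fun u => u - t ∈ V).card : ℝ) := by
  by_contra hcon
  push Not at hcon
  have hS : 0 ≤ S := by
    rcases h with h | h <;> exact le_trans (Nat.cast_nonneg _) h
  have key : ∃ n : ℕ, ∃ g : F × F → F, ((U.card : ℝ) * V.card) ^ 2 ≤ S * n ∧
      (n : ℝ) ≤ ∑ p ∈ U ×ˢ V, ((U.filter fun u => u - g p ∈ V).card : ℝ) := by
    rcases h with h | h
    · refine ⟨(((U ×ˢ V) ×ˢ (U ×ˢ V)).filter fun p => p.1.1 + p.1.2 = p.2.1 + p.2.2).card,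
        fun p => p.1 - p.2, ?_, ?_⟩
      · have := cs_image (U ×ˢ V) (fun p : F × F => p.1 + p.2)
        have h3 : (U ×ˢ V).image (fun p : F × F => p.1 + p.2) = U + V := rfl
        rw [h3, Finset.card_product] at this
        have h4 : (((U.card * V.card) ^ 2 : ℕ) : ℝ) ≤ _ := Nat.cast_le.2 this
        push_cast at h4
        exact h4.trans (mul_le_mul_of_nonneg_right h (Nat.cast_nonneg _))
      · rw [← Nat.cast_sum, ← Finset.card_sigma]
        norm_cast
        refine Finset.card_le_card_of_injOn (fun p => ⟨(p.1.1, p.2.2), p.2.1⟩) ?_ ?_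
        · rintro ⟨⟨u1, v1⟩, ⟨u2, v2⟩⟩ hp
          simp only [Finset.coe_filter, Finset.mem_product, Set.mem_ofPred_eq] at hp
          simp only [Finset.coe_sigma, Set.mem_sigma_iff, Finset.mem_coe, Finset.mem_product,
            Finset.mem_filter]
          refine ⟨⟨hp.1.1.1, hp.1.2.2⟩, hp.1.2.1, ?_⟩
          have : u2 - (u1 - v2) = v1 := by linear_combination - hp.2
          rw [this]; exact hp.1.1.2
        · rintro ⟨⟨u1, v1⟩, ⟨u2, v2⟩⟩ hp ⟨⟨u1', v1'⟩, ⟨u2', v2'⟩⟩ hp' heq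
          simp only [Finset.coe_filter, Finset.mem_product, Set.mem_ofPred_eq] at hp hp'
          simp only [Sigma.mk.injEq, Prod.mk.injEq, heq_eq_eq] at heq
          obtain ⟨⟨rfl, rfl⟩, rfl⟩ := heq
          have : v1 = v1' := by linear_combination hp.2 - hp'.2
          subst this; rfl
    · refine ⟨(((U ×ˢ V) ×ˢ (U ×ˢ V)).filter fun p => p.1.1 - p.1.2 = p.2.1 - p.2.2).card,
        fun p => p.1 - p.2, ?_, ?_⟩
      · have := cs_image (U ×ˢ V) (fun p : F × F => p.1 - p.2)
        have h3 : (U ×ˢ V).image (fun p : F × F => p.1 - p.2) = U - V := rfl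
        rw [h3, Finset.card_product] at this
        have h4 : (((U.card * V.card) ^ 2 : ℕ) : ℝ) ≤ _ := Nat.cast_le.2 this
        push_cast at h4
        exact h4.trans (mul_le_mul_of_nonneg_right h (Nat.cast_nonneg _))
      · rw [← Nat.cast_sum, ← Finset.card_sigma]
        norm_cast
        refine Finset.card_le_card_of_injOn (fun p => ⟨(p.1.1, p.1.2), p.2.1⟩) ?_ ?_
        · rintro ⟨⟨u1, v1⟩, ⟨u2, v2⟩⟩ hp
          simp only [Finset.coe_filter, Finset.mem_product, Set.mem_ofPred_eq] at hp
          simp only [Finset.coe_sigma, Set.mem_sigma_iff, Finset.mem_coe, Finset.mem_product,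
            Finset.mem_filter]
          refine ⟨⟨hp.1.1.1, hp.1.1.2⟩, hp.1.2.1, ?_⟩
          have : u2 - (u1 - v1) = v2 := by linear_combination - hp.2
          rw [this]; exact hp.1.2.2
        · rintro ⟨⟨u1, v1⟩, ⟨u2, v2⟩⟩ hp ⟨⟨u1', v1'⟩, ⟨u2', v2'⟩⟩ hp' heq
          simp only [Finset.coe_filter, Finset.mem_product, Set.mem_ofPred_eq] at hp hp'
          simp only [Sigma.mk.injEq, Prod.mk.injEq, heq_eq_eq] at heq
          obtain ⟨⟨rfl, rfl⟩, rfl⟩ := heq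
          have : v2 = v2' := by linear_combination hp.2 - hp'.2
          subst this; rfl
  obtain ⟨n, g, hn1, hn2⟩ := key
  have h5 : S * ∑ p ∈ U ×ˢ V, ((U.filter fun u => u - g p ∈ V).card : ℝ)
      < ∑ p ∈ U ×ˢ V, ((U.card : ℝ) * V.card) := by
    rw [Finset.mul_sum]
    exact Finset.sum_lt_sum_of_nonempty (hU.product hV) fun p _ => hcon (g p)
  rw [Finset.sum_const, Finset.card_product, nsmul_eq_mul] at h5
  push_cast at h5
  have := mul_le_mul_of_nonneg_left hn2 hS
  nlinarith

/-- Most of `U` is covered by few translates of `V`. -/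
lemma cover_aux (V : Finset F) (hV : V.Nonempty) (S κ : ℝ) (hκ : 0 < κ) :
    ∀ n : ℕ, ∀ U : Finset F, U.card ≤ n →
    (((U + V).card : ℝ) ≤ S ∨ ((U - V).card : ℝ) ≤ S) →
    ∃ T : Finset F, (T.card : ℝ) * (κ * V.card) ≤ S * U.card ∧
      ((U.filter fun u => ∀ t ∈ T, u - t ∉ V).card : ℝ) ≤ κ := by
  intro n
  induction n with
  | zero =>
    intro U hU h
    refine ⟨∅, ?_, ?_⟩
    · have : U.card = 0 := by omega
      simp [this]
    · have : U = ∅ := Finset.card_eq_zero.1 (by omega)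
      subst this
      simp [hκ.le]
  | succ n ih =>
    intro U hU h
    have hS : 0 ≤ S := by
      rcases h with h | h <;> exact le_trans (Nat.cast_nonneg _) h
    by_cases hsmall : (U.card : ℝ) ≤ κ
    · refine ⟨∅, ?_, ?_⟩
      · simp; positivity
      · simpa using hsmall
    push Not at hsmall
    have hUpos : (0 : ℝ) < U.card := hκ.trans hsmall
    have hUne : U.Nonempty := Finset.card_pos.1 (by exact_mod_cast hUpos)
    have hVpos : (0 : ℝ) < V.card := by exact_mod_cast hV.card_pos
    obtain ⟨t, ht⟩ := exists_translate U V hUne hV S h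
    set U1 := U.filter fun u => u - t ∉ V with hU1
    have hcard : (U.filter fun u => u - t ∈ V).card + U1.card = U.card :=
      Finset.card_filter_add_card_filter_not _
    have hrpos : 0 < (U.filter fun u => u - t ∈ V).card := by
      by_contra h0
      have : (U.filter fun u => u - t ∈ V).card = 0 := by omega
      rw [this] at ht
      have := mul_pos hUpos hVpos
      simp at ht
      linarith
    have hsub : U1 ⊆ U := Finset.filter_subset _ _
    obtain ⟨T1, hT1, hT1'⟩ := ih U1 (by omega) (by
      rcases h with h | h
      · left
        exact le_trans (Nat.cast_le.2 (Finset.card_le_card (Finset.add_subset_add_right hsub))) h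
      · right
        exact le_trans (Nat.cast_le.2 (Finset.card_le_card (Finset.sub_subset_sub_right hsub))) h)
    refine ⟨insert t T1, ?_, ?_⟩
    · have h1 : ((insert t T1).card : ℝ) ≤ T1.card + 1 := by
        exact_mod_cast Finset.card_insert_le t T1
      have h2 : (U.card : ℝ) = (U.filter fun u => u - t ∈ V).card + U1.card := by
        exact_mod_cast hcard.symm
      calc ((insert t T1).card : ℝ) * (κ * V.card) ≤ (T1.card + 1) * (κ * V.card) := by gcongr
        _ = T1.card * (κ * V.card) + κ * V.card := by ring
        _ ≤ S * U1.card + U.card * V.card := by gcongr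
        _ ≤ S * U1.card + S * (U.filter fun u => u - t ∈ V).card := by gcongr
        _ = S * U.card := by rw [h2]; ring
    · refine le_trans (Nat.cast_le.2 (Finset.card_le_card ?_)) hT1'
      intro u hu
      simp only [Finset.mem_filter, Finset.mem_insert, forall_eq_or_imp, hU1] at hu ⊢
      exact ⟨⟨hu.1, hu.2.1⟩, hu.2.2⟩

/-- `t U` is mostly covered by few translates of `± lam A`. -/
def Good (A : Finset F) (S N : ℝ) (lam t : F) : Prop :=
  ∀ U ⊆ A, ∀ η : ℝ, 0 < η → ∀ s : F, (s = 1 ∨ s = -1) →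
    ∃ T : Finset F, (T.card : ℝ) * (η * N) ≤ S ∧
      ((U.filter fun u => ∀ w ∈ T, ∀ a ∈ A, t * u ≠ w + s * (lam * a)).card : ℝ) ≤ η * U.card

lemma Good.neg {A : Finset F} {S N : ℝ} {lam t : F} (h : Good A S N lam t) :
    Good A S N lam (-t) := by
  intro U hU η hη s hs
  obtain ⟨T, hT1, hT2⟩ := h U hU η hη (-s) (by
    rcases hs with rfl | rfl
    · right; rfl
    · left; ring)
  refine ⟨-T, by simpa using hT1, le_trans (Nat.cast_le.2 (Finset.card_le_card ?_)) hT2⟩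
  intro u hu
  simp only [Finset.mem_filter] at hu ⊢
  refine ⟨hu.1, fun w hw a ha heq => hu.2 (-w) (by simpa using hw) a ha ?_⟩
  linear_combination - heq

lemma Good.sign {A : Finset F} {S N : ℝ} {lam t e : F} (h : Good A S N lam t)
    (he : e = 1 ∨ e = -1) : Good A S N lam (e * t) := by
  rcases he with rfl | rfl
  · simpa using h
  · simpa using h.neg

lemma good_of {A P : Finset F} {S N : ℝ} {lam t : F} (hN : 0 < N)
    (h : ((A + A).card : ℝ) ≤ S ∨ ((A - A).card : ℝ) ≤ S) (hP : P ⊆ A) (hPN : N ≤ P.card)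
    (hPt : ∀ p ∈ P, ∃ a ∈ A, t * p = lam * a) : Good A S N lam t := by
  intro U hU η hη s hs
  have hS : 0 ≤ S := by
    rcases h with h | h <;> exact le_trans (Nat.cast_nonneg _) h
  rcases U.eq_empty_or_nonempty with rfl | hUne
  · exact ⟨∅, by simpa using hS, by simp⟩
  have hUpos : (0 : ℝ) < U.card := by exact_mod_cast hUne.card_pos
  have hPpos : 0 < P.card := by
    have : (0 : ℝ) < P.card := hN.trans_le hPN
    exact_mod_cast this
  have hPne : P.Nonempty := Finset.card_pos.1 hPpos
  have main : ∃ V : Finset F, V.Nonempty ∧ V.card = P.card ∧ (∀ v ∈ V, ∃ p ∈ P, v = s * p) ∧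
      (((U + V).card : ℝ) ≤ S ∨ ((U - V).card : ℝ) ≤ S) := by
    have ha : ((U + P).card : ℝ) ≤ (A + A).card :=
      Nat.cast_le.2 (Finset.card_le_card (Finset.add_subset_add hU hP))
    have hb : ((U - P).card : ℝ) ≤ (A - A).card :=
      Nat.cast_le.2 (Finset.card_le_card (Finset.sub_subset_sub hU hP))
    rcases hs with rfl | rfl
    · refine ⟨P, hPne, rfl, fun v hv => ⟨v, hv, by ring⟩, ?_⟩
      rcases h with h | h
      · left; linarith
      · right; linarith
    · refine ⟨-P, by simpa using hPne, by simp, fun v hv => ⟨-v, by simpa using hv, by ring⟩, ?_⟩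
      rw [sub_neg_eq_add, ← sub_eq_add_neg]
      rcases h with h | h
      · right; linarith
      · left; linarith
  obtain ⟨V, hVne, hVc, hVs, hV⟩ := main
  obtain ⟨T, hT1, hT2⟩ := cover_aux V hVne S (η * U.card) (by positivity) _ U le_rfl hV
  refine ⟨T.image (t * ·), ?_, le_trans (Nat.cast_le.2 (Finset.card_le_card ?_)) hT2⟩
  · have h1 : ((T.image (t * ·)).card : ℝ) ≤ T.card := Nat.cast_le.2 Finset.card_image_le
    have h2 : (T.card : ℝ) * (η * V.card) ≤ S := by
      have : (T.card : ℝ) * (η * V.card) * U.card ≤ S * U.card := by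
        calc _ = (T.card : ℝ) * (η * U.card * V.card) := by ring
          _ ≤ _ := hT1
      exact le_of_mul_le_mul_right this hUpos
    rw [hVc] at h2
    calc _ ≤ (T.card : ℝ) * (η * P.card) := by gcongr
      _ ≤ S := h2
  · intro u hu
    simp only [Finset.mem_filter] at hu ⊢
    refine ⟨hu.1, fun w hw hmem => ?_⟩
    obtain ⟨p, hp, hps⟩ := hVs _ hmem
    obtain ⟨a, ha, hta⟩ := hPt p hp
    refine hu.2 (t * w) (Finset.mem_image_of_mem _ hw) a ha ?_
    linear_combination t * hps + s * hta

/-- the four-fold sum set -/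
def q4 (A : Finset F) (e : F) : Finset F := A + (A + A + A).image (e * ·)

lemma fourcover {A Y1 Y2 : Finset F} {S N Q η k : ℝ} {lam t1 t2 t3 t4 e : F}
    (he : e = 1 ∨ e = -1) (hN : 0 < N) (hη : 0 < η) (hk : 0 ≤ k) (hS : 0 ≤ S)
    (hQ : ((q4 A e).card : ℝ) ≤ Q) (hY1 : Y1 ⊆ A) (hY2 : Y2 ⊆ A)
    (h1 : ∃ T : Finset F, (T.card : ℝ) ≤ k ∧
      ((Y1.filter fun u => ∀ w ∈ T, ∀ a ∈ A, t1 * u ≠ w + lam * a).card : ℝ) ≤ η * Y1.card)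
    (h2 : Good A S N lam t2) (h3 : Good A S N lam t3) (h4 : Good A S N lam t4) :
    ∃ Y1' ⊆ Y1, ∃ Y2' ⊆ Y2, ((Y1 \ Y1').card : ℝ) ≤ 2 * η * Y1.card ∧
      ((Y2 \ Y2').card : ℝ) ≤ 2 * η * Y2.card ∧
      (((Y1' ×ˢ Y2').image fun p : F × F => (t1 + t2) * p.1 + (t3 + t4) * p.2).card : ℝ) ≤
        k * (S / (η * N)) ^ 3 * Q := by
  obtain ⟨T1, hT1, hB1⟩ := h1
  obtain ⟨T2, hT2, hB2⟩ := h2 Y1 hY1 η hη e he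
  obtain ⟨T3, hT3, hB3⟩ := h3 Y2 hY2 η hη e he
  obtain ⟨T4, hT4, hB4⟩ := h4 Y2 hY2 η hη e he
  have hηN : 0 < η * N := by positivity
  rw [← le_div_iff₀ hηN] at hT2 hT3 hT4
  set B1 := Y1.filter fun u => ∀ w ∈ T1, ∀ a ∈ A, t1 * u ≠ w + lam * a with hB1d
  set B2 := Y1.filter fun u => ∀ w ∈ T2, ∀ a ∈ A, t2 * u ≠ w + e * (lam * a) with hB2d
  set B3 := Y2.filter fun u => ∀ w ∈ T3, ∀ a ∈ A, t3 * u ≠ w + e * (lam * a) with hB3d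
  set B4 := Y2.filter fun u => ∀ w ∈ T4, ∀ a ∈ A, t4 * u ≠ w + e * (lam * a) with hB4d
  refine ⟨Y1 \ (B1 ∪ B2), Finset.sdiff_subset, Y2 \ (B3 ∪ B4), Finset.sdiff_subset, ?_, ?_, ?_⟩
  · have : Y1 \ (Y1 \ (B1 ∪ B2)) ⊆ B1 ∪ B2 := by
      intro x hx; simp only [Finset.mem_sdiff] at hx; tauto
    have h5 : ((Y1 \ (Y1 \ (B1 ∪ B2))).card : ℝ) ≤ B1.card + B2.card := by
      exact_mod_cast (Finset.card_le_card this).trans (Finset.card_union_le _ _)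
    linarith
  · have : Y2 \ (Y2 \ (B3 ∪ B4)) ⊆ B3 ∪ B4 := by
      intro x hx; simp only [Finset.mem_sdiff] at hx; tauto
    have h5 : ((Y2 \ (Y2 \ (B3 ∪ B4))).card : ℝ) ≤ B3.card + B4.card := by
      exact_mod_cast (Finset.card_le_card this).trans (Finset.card_union_le _ _)
    linarith
  · have hsub : ((Y1 \ (B1 ∪ B2)) ×ˢ (Y2 \ (B3 ∪ B4))).image
        (fun p : F × F => (t1 + t2) * p.1 + (t3 + t4) * p.2)
        ⊆ (T1 + (T2 + (T3 + T4))) + (q4 A e).image (lam * ·) := by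
      intro v hv
      simp only [Finset.mem_image, Finset.mem_product, Finset.mem_sdiff, Finset.mem_union,
        Prod.exists] at hv
      obtain ⟨x, y, ⟨⟨hx, hxB⟩, hy, hyB⟩, rfl⟩ := hv
      simp only [hB1d, hB2d, hB3d, hB4d, Finset.mem_filter, hx, hy, true_and, not_or] at hxB hyB
      obtain ⟨hx1, hx2⟩ := hxB
      obtain ⟨hx3, hx4⟩ := hyB
      push Not at hx1 hx2 hx3 hx4
      obtain ⟨w1, hw1, a1, ha1, e1⟩ := hx1
      obtain ⟨w2, hw2, a2, ha2, e2⟩ := hx2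
      obtain ⟨w3, hw3, a3, ha3, e3⟩ := hx3
      obtain ⟨w4, hw4, a4, ha4, e4⟩ := hx4
      have hq : a1 + e * (a2 + a3 + a4) ∈ q4 A e :=
        Finset.add_mem_add ha1 (Finset.mem_image_of_mem _
          (Finset.add_mem_add (Finset.add_mem_add ha2 ha3) ha4))
      have : (t1 + t2) * x + (t3 + t4) * y
          = (w1 + (w2 + (w3 + w4))) + lam * (a1 + e * (a2 + a3 + a4)) := by
        linear_combination e1 + e2 + e3 + e4
      rw [this]
      exact Finset.add_mem_add (Finset.add_mem_add hw1 (Finset.add_mem_add hw2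
        (Finset.add_mem_add hw3 hw4))) (Finset.mem_image_of_mem _ hq)
    have hc : (T1 + (T2 + (T3 + T4)) + (q4 A e).image (lam * ·)).card
        ≤ (T1.card * (T2.card * (T3.card * T4.card))) * (q4 A e).card := by
      refine Finset.card_add_le.trans (Nat.mul_le_mul ?_ Finset.card_image_le)
      refine Finset.card_add_le.trans (Nat.mul_le_mul le_rfl ?_)
      refine Finset.card_add_le.trans (Nat.mul_le_mul le_rfl ?_)
      exact Finset.card_add_le
    have hc' : (((T1 + (T2 + (T3 + T4)) + (q4 A e).image (lam * ·)).card : ℕ) : ℝ)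
        ≤ (T1.card * (T2.card * (T3.card * T4.card))) * (q4 A e).card := by exact_mod_cast hc
    refine le_trans (Nat.cast_le.2 (Finset.card_le_card hsub)) (hc'.trans ?_)
    have hd : 0 ≤ S / (η * N) := by positivity
    calc ((T1.card : ℝ) * (T2.card * (T3.card * T4.card))) * (q4 A e).card
        ≤ (k * (S / (η * N) * (S / (η * N) * (S / (η * N))))) * Q := by gcongr
      _ = _ := by ring

lemma four_inj {A X : Finset F} {S N Q : ℝ} {lam a b c d r e : F} {W : Finset (F × F)}
    (he : e = 1 ∨ e = -1) (hN : 0 < N) (hS : 0 ≤ S)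
    (hQ : ((q4 A e).card : ℝ) ≤ Q) (hX : X ⊆ A)
    (ha : Good A S N lam a) (hb : Good A S N lam b) (hc : Good A S N lam c)
    (hd : Good A S N lam d) (hcd : c ≠ d) (hr : r * (c - d) = a - b)
    (hW : W ⊆ X ×ˢ X) (hWc : (X.card : ℝ) ^ 2 ≤ 4 * W.card)
    (hinj : Set.InjOn (fun p : F × F => p.1 + r * p.2) W) :
    (X.card : ℝ) ^ 2 * N ^ 4 ≤ 8 * 32 ^ 4 * S ^ 4 * Q := by
  have hη : (0 : ℝ) < 1 / 32 := by norm_num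
  have hk : 0 ≤ S / ((1 / 32) * N) := by positivity
  obtain ⟨Y1, hY1, Y2, hY2, h1, h2, h3⟩ := fourcover (e := e) (Q := Q) (η := 1 / 32)
    (k := S / ((1 / 32) * N)) he hN hη hk hS hQ hX hX (by
      obtain ⟨T, hT, hT'⟩ := hc X hX (1 / 32) hη 1 (Or.inl rfl)
      refine ⟨T, ?_, ?_⟩
      · rwa [le_div_iff₀ (by positivity)]
      · simpa using hT') hd.neg ha hb.neg
  set W' := W ∩ (Y1 ×ˢ Y2) with hW'
  have hWsub : W \ W' ⊆ ((X \ Y1) ×ˢ X) ∪ (X ×ˢ (X \ Y2)) := by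
    rintro ⟨x, y⟩ hp
    simp only [hW', Finset.mem_sdiff, Finset.mem_inter, Finset.mem_product, not_and] at hp
    have hp' := Finset.mem_product.1 (hW hp.1)
    simp only [Finset.mem_union, Finset.mem_product, Finset.mem_sdiff]
    have := hp.2 hp.1
    by_cases hx : x ∈ Y1
    · exact Or.inr ⟨hp'.1, hp'.2, this hx⟩
    · exact Or.inl ⟨⟨hp'.1, hx⟩, hp'.2⟩
  have hcard : (W.card : ℝ) ≤ W'.card + ((X \ Y1).card * X.card + X.card * (X \ Y2).card) := by
    have e1 : W.card = (W \ W').card + W'.card :=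
      (Finset.card_sdiff_add_card_eq_card Finset.inter_subset_left).symm
    have e2 := (Finset.card_le_card hWsub).trans (Finset.card_union_le _ _)
    rw [Finset.card_product, Finset.card_product] at e2
    exact_mod_cast (by omega : W.card ≤ W'.card + ((X \ Y1).card * X.card + X.card * (X \ Y2).card))
  have hX0 : (0 : ℝ) ≤ X.card := Nat.cast_nonneg _
  have hW'c : (X.card : ℝ) ^ 2 / 8 ≤ W'.card := by nlinarith
  have himg : (W'.card : ℝ) ≤ S / ((1 / 32) * N) * (S / ((1 / 32) * N)) ^ 3 * Q := by
    refine le_trans (Nat.cast_le.2 ?_) h3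
    refine Finset.card_le_card_of_injOn
      (fun p : F × F => (c + -d) * p.1 + (a + -b) * p.2) ?_ ?_
    · intro p hp
      exact Finset.mem_coe.2 (Finset.mem_image_of_mem _ (Finset.mem_inter.1 (Finset.mem_coe.1 hp)).2)
    · intro p hp p' hp' heq
      refine hinj (Finset.inter_subset_left (Finset.mem_coe.1 hp))
        (Finset.inter_subset_left (Finset.mem_coe.1 hp')) ?_
      have hne : c - d ≠ 0 := sub_ne_zero.2 hcd
      apply mul_left_cancel₀ hne
      simp only at heq ⊢
      linear_combination heq + (p.2 - p'.2) * hr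
  have e3 : S / ((1 / 32) * N) * (S / ((1 / 32) * N)) ^ 3 * Q = 32 ^ 4 * S ^ 4 * Q / N ^ 4 := by
    field_simp
  rw [e3] at himg
  have e4 := hW'c.trans himg
  rw [le_div_iff₀ (by positivity)] at e4
  linarith

lemma trivial_cover {A Y : Finset F} {η : ℝ} (hη : 0 < η) {lam c : F}
    (hc : ∀ y ∈ Y, ∃ x ∈ A, c * y = lam * x) :
    ∃ T : Finset F, (T.card : ℝ) ≤ 1 ∧
      ((Y.filter fun u => ∀ w ∈ T, ∀ a ∈ A, c * u ≠ w + lam * a).card : ℝ) ≤ η * Y.card := by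
  refine ⟨{0}, by simp, ?_⟩
  rw [Finset.card_eq_zero.2 (Finset.eq_empty_of_forall_notMem ?_)]
  · simp; positivity
  · intro y hy
    obtain ⟨hy1, hy2⟩ := Finset.mem_filter.1 hy
    obtain ⟨x, hx, hxy⟩ := hc y hy1
    exact hy2 0 (by simp) x hx (by simpa using hxy)

lemma three_inj {A Y1 Y2 : Finset F} {S N Q : ℝ} {lam a b c d r e : F}
    (he : e = 1 ∨ e = -1) (hN : 0 < N) (hS : 0 ≤ S)
    (hQ : ((q4 A e).card : ℝ) ≤ Q) (hY1 : Y1 ⊆ A) (hY2 : Y2 ⊆ A)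
    (ha : Good A S N lam a) (hb : Good A S N lam b)
    (hc : ∀ y ∈ Y1, ∃ x ∈ A, c * y = lam * x)
    (hd : Good A S N lam d) (hcd : c ≠ d) (hr : r * (c - d) = a - b)
    (hinj : Set.InjOn (fun p : F × F => p.1 + r * p.2) (Y1 ×ˢ Y2 : Finset (F × F))) :
    (Y1.card : ℝ) * Y2.card * N ^ 3 ≤ 256 * S ^ 3 * Q := by
  have hη : (0 : ℝ) < 1 / 4 := by norm_num
  obtain ⟨Z1, hZ1, Z2, hZ2, h1, h2, h3⟩ := fourcover (e := e) (Q := Q) (η := 1 / 4)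
    (k := 1) he hN hη zero_le_one hS hQ hY1 hY2 (trivial_cover hη hc) hd.neg ha hb.neg
  have c1 : ((Y1 \ Z1).card : ℝ) + Z1.card = Y1.card := by
    exact_mod_cast Finset.card_sdiff_add_card_eq_card hZ1
  have c2 : ((Y2 \ Z2).card : ℝ) + Z2.card = Y2.card := by
    exact_mod_cast Finset.card_sdiff_add_card_eq_card hZ2
  have himg : ((Z1.card * Z2.card : ℕ) : ℝ) ≤ 1 * (S / ((1 / 4) * N)) ^ 3 * Q := by
    refine le_trans (Nat.cast_le.2 ?_) h3
    rw [← Finset.card_product]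
    refine Finset.card_le_card_of_injOn
      (fun p : F × F => (c + -d) * p.1 + (a + -b) * p.2) ?_ ?_
    · intro p hp
      exact Finset.mem_coe.2 (Finset.mem_image_of_mem _ (Finset.mem_coe.1 hp))
    · intro p hp p' hp' heq
      refine hinj (Finset.product_subset_product hZ1 hZ2 (Finset.mem_coe.1 hp))
        (Finset.product_subset_product hZ1 hZ2 (Finset.mem_coe.1 hp')) ?_
      have hne : c - d ≠ 0 := sub_ne_zero.2 hcd
      apply mul_left_cancel₀ hne
      simp only at heq ⊢
      linear_combination heq + (p.2 - p'.2) * hr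
  have e3 : 1 * (S / ((1 / 4) * N)) ^ 3 * Q = 64 * S ^ 3 * Q / N ^ 3 := by
    field_simp; ring
  rw [e3, le_div_iff₀ (by positivity)] at himg
  push_cast at himg
  have hh : (Y1.card : ℝ) / 2 * (Y2.card / 2) ≤ Z1.card * Z2.card := by
    apply mul_le_mul
    · linarith
    · linarith
    · positivity
    · positivity
  have := mul_le_mul_of_nonneg_right hh (by positivity : (0:ℝ) ≤ N ^ 3)
  linarith

lemma exists_petridis {G : Type*} [DecidableEq G] [AddCommGroup G] (X B : Finset G) (hX : X.Nonempty) :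
    ∃ X' ⊆ X, X'.Nonempty ∧ (X' + B).card * X.card ≤ (X + B).card * X'.card ∧
      ∀ A' ⊆ X', (X' + B).card * A'.card ≤ (A' + B).card * X'.card := by
  have hX' : X ∈ X.powerset.erase ∅ :=
    Finset.mem_erase_of_ne_of_mem hX.ne_empty (Finset.mem_powerset_self _)
  obtain ⟨C, hC, hCmin⟩ := Finset.exists_min_image (X.powerset.erase ∅)
    (fun C ↦ ((C + B).card : ℚ) / C.card) ⟨X, hX'⟩
  rw [Finset.mem_erase, Finset.mem_powerset, ← Finset.nonempty_iff_ne_empty] at hC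
  have key : ∀ A' ⊆ X, (C + B).card * A'.card ≤ (A' + B).card * C.card := by
    intro A' hA'
    rcases A'.eq_empty_or_nonempty with rfl | hne
    · simp
    have := hCmin A' (Finset.mem_erase_of_ne_of_mem hne.ne_empty (Finset.mem_powerset.2 hA'))
    have p1 : (0 : ℚ) < C.card := by exact_mod_cast hC.1.card_pos
    have p2 : (0 : ℚ) < A'.card := by exact_mod_cast hne.card_pos
    rw [div_le_div_iff₀ p1 p2] at this
    exact_mod_cast this
  exact ⟨C, hC.2, hC.1, key X (Finset.Subset.refl _), fun A' h => key A' (h.trans hC.2)⟩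

lemma petridis_two {G : Type*} [DecidableEq G] [AddCommGroup G] (X B : Finset G) (hX : X.Nonempty) :
    ∃ X' ⊆ X, X'.Nonempty ∧
      ((X' + B + B).card : ℝ) * X.card ^ 2 ≤ ((X + B).card : ℝ) ^ 2 * X'.card ∧
      ((X' + B + B + B).card : ℝ) * X.card ^ 3 ≤ ((X + B).card : ℝ) ^ 3 * X'.card := by
  obtain ⟨X', hsub, hne, h1, h2⟩ := exists_petridis X B hX
  have p : (0 : ℝ) < X'.card := by exact_mod_cast hne.card_pos
  have p0 : (0 : ℝ) < X.card := by exact_mod_cast hX.card_pos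
  have k2 := Finset.pluennecke_petridis_inequality_add (A := X') (B := B) B h2
  have k3 := Finset.pluennecke_petridis_inequality_add (A := X') (B := B) (B + B) h2
  have r2 : B + X' + B = X' + B + B := by rw [add_comm B X']
  have r2' : B + X' = X' + B := add_comm _ _
  have r3 : B + B + X' + B = X' + B + B + B := by
    rw [add_comm (B + B) X', ← add_assoc]
  have r3' : B + B + X' = X' + B + B := by rw [add_comm (B + B) X', ← add_assoc]
  rw [r2, r2'] at k2
  rw [r3, r3'] at k3
  have k1' : ((X' + B).card : ℝ) * X.card ≤ (X + B).card * X'.card := by exact_mod_cast h1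
  have k2' : ((X' + B + B).card : ℝ) * X'.card ≤ (X' + B).card * (X' + B).card := by
    exact_mod_cast k2
  have k3' : ((X' + B + B + B).card : ℝ) * X'.card ≤ (X' + B).card * (X' + B + B).card := by
    exact_mod_cast k3
  set x1 : ℝ := ((X' + B).card : ℝ)
  set x2 : ℝ := ((X' + B + B).card : ℝ)
  set x3 : ℝ := ((X' + B + B + B).card : ℝ)
  set n : ℝ := (X.card : ℝ)
  set n' : ℝ := (X'.card : ℝ)
  set s : ℝ := ((X + B).card : ℝ)
  have hx1 : 0 ≤ x1 := Nat.cast_nonneg _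
  have hx2 : 0 ≤ x2 := Nat.cast_nonneg _
  have hs : 0 ≤ s := Nat.cast_nonneg _
  have t2 : x2 * n ^ 2 ≤ s ^ 2 * n' := by
    have : x2 * n ^ 2 * n' ≤ s ^ 2 * n' * n' := by
      calc x2 * n ^ 2 * n' = x2 * n' * n ^ 2 := by ring
        _ ≤ x1 * x1 * n ^ 2 := by gcongr
        _ = (x1 * n) * (x1 * n) := by ring
        _ ≤ (s * n') * (s * n') := by gcongr
        _ = _ := by ring
    exact le_of_mul_le_mul_right this p
  refine ⟨X', hsub, hne, t2, ?_⟩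
  have : x3 * n ^ 3 * n' ≤ s ^ 3 * n' * n' := by
    calc x3 * n ^ 3 * n' = x3 * n' * n ^ 3 := by ring
      _ ≤ x1 * x2 * n ^ 3 := by gcongr
      _ = (x1 * n) * (x2 * n ^ 2) := by ring
      _ ≤ (s * n') * (s ^ 2 * n') := by gcongr
      _ = _ := by ring
  exact le_of_mul_le_mul_right this p

/-- Pluennecke's inequality with two different summands. -/
lemma two_summand (X B1 B2 : Finset F) (hX : X.Nonempty) :
    ∃ X' ⊆ X, X'.Nonempty ∧ ((X' + (B1 + B2)).card : ℝ) * X.card ^ 2 ≤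
      4 * (X + B1).card * (X + B2).card * X'.card := by
  rcases B1.eq_empty_or_nonempty with rfl | hB1
  · exact ⟨X, Finset.Subset.refl _, hX, by simp⟩
  rcases B2.eq_empty_or_nonempty with rfl | hB2
  · exact ⟨X, Finset.Subset.refl _, hX, by simp⟩
  have h1 : 0 < (X + B1).card := (hX.add hB1).card_pos
  have h2 : 0 < (X + B2).card := (hX.add hB2).card_pos
  obtain ⟨s1, hs1⟩ : ∃ s, s = (X + B1).card := ⟨_, rfl⟩
  obtain ⟨s2, hs2⟩ : ∃ s, s = (X + B2).card := ⟨_, rfl⟩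
  rw [← hs1] at h1 ⊢
  rw [← hs2] at h2 ⊢
  have : NeZero s1 := ⟨h1.ne'⟩
  have : NeZero s2 := ⟨h2.ne'⟩
  let H1 : Finset (ZMod s2) := Finset.univ
  let H2 : Finset (ZMod s1) := Finset.univ
  have cH1 : H1.card = s2 := by simp [H1, ZMod.card]
  have cH2 : H2.card = s1 := by simp [H2, ZMod.card]
  let Xt : Finset (F × ZMod s2 × ZMod s1) := X ×ˢ ({0} ×ˢ {0})
  let Bt : Finset (F × ZMod s2 × ZMod s1) := (B1 ×ˢ (H1 ×ˢ {0})) ∪ (B2 ×ˢ ({0} ×ˢ H2))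
  have hXt : Xt.Nonempty := by
    obtain ⟨x, hx⟩ := hX
    exact ⟨(x, 0, 0), by simp [Xt, hx]⟩
  have cXt : Xt.card = X.card := by simp [Xt]
  have cXB : (Xt + Bt).card ≤ 2 * s1 * s2 := by
    have : Xt + Bt ⊆ ((X + B1) ×ˢ (H1 ×ˢ {0})) ∪ ((X + B2) ×ˢ ({0} ×ˢ H2)) := by
      intro p hp
      obtain ⟨⟨x, x1, x2⟩, hx, ⟨b, b1, b2⟩, hb, rfl⟩ := Finset.mem_add.1 hp
      simp only [Xt, Bt, Finset.mem_product, Finset.mem_singleton, Finset.mem_union] at hx hb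
      obtain ⟨hx, rfl, rfl⟩ := hx
      rcases hb with ⟨hb, hb1, rfl⟩ | ⟨hb, rfl, hb2⟩
      · refine Finset.mem_union_left _ ?_
        simp only [Finset.mem_product, Finset.mem_singleton]
        exact ⟨Finset.add_mem_add hx hb, Finset.mem_univ _, by simp⟩
      · refine Finset.mem_union_right _ ?_
        simp only [Finset.mem_product, Finset.mem_singleton]
        exact ⟨Finset.add_mem_add hx hb, by simp, Finset.mem_univ _⟩
    refine (Finset.card_le_card this).trans ((Finset.card_union_le _ _).trans ?_)
    simp only [Finset.card_product, Finset.card_singleton, cH1, cH2, ← hs1, ← hs2]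
    apply le_of_eq; ring
  obtain ⟨Y, hY, hYne, hY2, -⟩ := petridis_two Xt Bt hXt
  let X' := Y.image Prod.fst
  have hYmem : ∀ y ∈ Y, y.1 ∈ X ∧ y.2 = 0 := by
    rintro ⟨y, y1, y2⟩ hy
    have := hY hy
    simp only [Xt, Finset.mem_product, Finset.mem_singleton] at this
    obtain ⟨h, rfl, rfl⟩ := this
    exact ⟨h, rfl⟩
  have cX' : X'.card = Y.card := by
    refine Finset.card_image_of_injOn ?_
    rintro y hy y' hy' heq
    exact Prod.ext heq ((hYmem y hy).2.trans (hYmem y' hy').2.symm)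
  refine ⟨X', ?_, hYne.image _, ?_⟩
  · intro x hx
    obtain ⟨y, hy, rfl⟩ := Finset.mem_image.1 hx
    exact (hYmem y hy).1
  have hbig : (X' + (B1 + B2)) ×ˢ (H1 ×ˢ H2) ⊆ Y + Bt + Bt := by
    rintro ⟨v, v1, v2⟩ hv
    have hv' := (Finset.mem_product.1 hv).1
    obtain ⟨x, hx, w, hw, rfl⟩ := Finset.mem_add.1 hv'
    obtain ⟨b1, hb1, b2, hb2, rfl⟩ := Finset.mem_add.1 hw
    obtain ⟨y, hy, rfl⟩ := Finset.mem_image.1 hx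
    have e1 : ((y.1 + (b1 + b2), v1, v2) : F × ZMod s2 × ZMod s1)
        = y + (b1, v1, 0) + (b2, 0, v2) := by
      have h0 := (hYmem y hy).2
      refine Prod.ext ?_ ?_
      · simp [add_assoc]
      · simp [h0]
    rw [e1]
    refine Finset.add_mem_add (Finset.add_mem_add hy ?_) ?_
    · simp [Bt, H1, hb1]
    · simp [Bt, H2, hb2]
  have cbig := Finset.card_le_card hbig
  rw [Finset.card_product, Finset.card_product, cH1, cH2] at cbig
  have cbig' : ((X' + (B1 + B2)).card : ℝ) * (s2 * s1) ≤ (Y + Bt + Bt).card := by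
    exact_mod_cast cbig
  have cXB' : ((Xt + Bt).card : ℝ) ≤ 2 * s1 * s2 := by exact_mod_cast cXB
  rw [cXt, ← cX'] at hY2
  have ps1 : (0 : ℝ) < s1 := by exact_mod_cast h1
  have ps2 : (0 : ℝ) < s2 := by exact_mod_cast h2
  have hfin : ((X' + (B1 + B2)).card : ℝ) * X.card ^ 2 * (s2 * s1)
      ≤ 4 * s1 * s2 * X'.card * (s2 * s1) := by
    calc ((X' + (B1 + B2)).card : ℝ) * X.card ^ 2 * (s2 * s1)
        = ((X' + (B1 + B2)).card : ℝ) * (s2 * s1) * X.card ^ 2 := by ring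
      _ ≤ ((Y + Bt + Bt).card : ℝ) * (X.card : ℝ) ^ 2 := by gcongr
      _ ≤ ((Xt + Bt).card : ℝ) ^ 2 * X'.card := hY2
      _ ≤ (2 * s1 * s2) ^ 2 * X'.card := by gcongr
      _ = _ := by ring
  exact le_of_mul_le_mul_right hfin (by positivity)

lemma union_pieces (D : Finset F) (κ ρ : ℝ) (hρ : 0 ≤ ρ) (hκ : 0 < κ) : ∀ n : ℕ, ∀ X : Finset F,
    X.card ≤ n →
    (∀ X1 ⊆ X, κ < (X1.card : ℝ) → ∃ X' ⊆ X1, X'.Nonempty ∧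
      ((X' + D).card : ℝ) ≤ ρ * X'.card) →
    ∃ X'' ⊆ X, ((X \ X'').card : ℝ) ≤ κ ∧ ((X'' + D).card : ℝ) ≤ ρ * X''.card := by
  intro n
  induction n with
  | zero =>
    intro X hX _
    have : X = ∅ := Finset.card_eq_zero.1 (by omega)
    subst this
    exact ⟨∅, Finset.Subset.refl _, by simpa using hκ.le, by simp⟩
  | succ n ih =>
    intro X hX h
    by_cases hs : (X.card : ℝ) ≤ κ
    · exact ⟨∅, Finset.empty_subset _, by simpa using hs, by simp⟩
    push Not at hs
    obtain ⟨X', hX', hne, hX'2⟩ := h X (Finset.Subset.refl _) hs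
    have hc : (X \ X').card + X'.card = X.card := Finset.card_sdiff_add_card_eq_card hX'
    have hp := hne.card_pos
    obtain ⟨X'', h1, h2, h3⟩ := ih (X \ X') (by omega)
      (fun X1 hX1 => h X1 (hX1.trans Finset.sdiff_subset))
    refine ⟨X' ∪ X'', Finset.union_subset hX' (h1.trans Finset.sdiff_subset), ?_, ?_⟩
    · have hE : X \ (X' ∪ X'') = (X \ X') \ X'' := by
        ext z; simp only [Finset.mem_sdiff, Finset.mem_union]; tauto
      rw [hE]; exact h2
    · rw [Finset.union_add]
      have hdis : Disjoint X' X'' :=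
        Finset.disjoint_of_subset_right h1 Finset.disjoint_sdiff
      rw [Finset.card_union_of_disjoint hdis]
      have : (((X' + D) ∪ (X'' + D)).card : ℝ) ≤ (X' + D).card + (X'' + D).card := by
        exact_mod_cast Finset.card_union_le _ _
      push_cast
      linarith

lemma plus_inj {A X Y : Finset F} {S N Q : ℝ} {lam a b c d r e : F}
    (he : e = 1 ∨ e = -1) (hN : 0 < N) (hS : 0 ≤ S)
    (hAe : ((A + A.image (e * ·)).card : ℝ) ≤ S)
    (hQ : ((q4 A e).card : ℝ) ≤ Q) (hX : X ⊆ A) (hY : Y ⊆ A)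
    (ha : ∀ y ∈ Y, ∃ x ∈ A, a * y = lam * x) (hb : Good A S N lam b)
    (hc : Good A S N lam c)
    (hd : Good A S N lam d) (hcd : c ≠ d) (hr : r * (c - d) = a - b)
    (hinj : Set.InjOn (fun p : F × F => p.1 + e * (1 + r) * p.2) (X ×ˢ Y : Finset (F × F))) :
    (X.card : ℝ) ^ 2 * Y.card * N ^ 3 ≤ 8192 * S ^ 4 * Q := by
  have hQ0 : 0 ≤ Q := le_trans (Nat.cast_nonneg _) hQ
  rcases X.eq_empty_or_nonempty with rfl | hXne
  · simp; positivity
  have hXpos : (0 : ℝ) < X.card := by exact_mod_cast hXne.card_pos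
  have hη : (0 : ℝ) < 1 / 4 := by norm_num
  have hee : e * e = 1 := by rcases he with rfl | rfl <;> ring
  obtain ⟨Z1, hZ1, Z2, hZ2, h1, h2, h3⟩ := fourcover (e := e) (Q := Q) (η := 1 / 4)
    (k := 1) he hN hη zero_le_one hS hQ hY hX (trivial_cover hη ha) hb.neg (hc.sign he) (hd.neg.sign he)
  have c1 : ((Y \ Z1).card : ℝ) + Z1.card = Y.card := by
    exact_mod_cast Finset.card_sdiff_add_card_eq_card hZ1
  have c2 : ((X \ Z2).card : ℝ) + Z2.card = X.card := by
    exact_mod_cast Finset.card_sdiff_add_card_eq_card hZ2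
  set Γ : ℝ := 1 * (S / ((1 / 4) * N)) ^ 3 * Q with hΓ
  let B1 : Finset F := Z1.image (e * ·)
  let B2 : Finset F := Z1.image (e * r * ·)
  have hne : c - d ≠ 0 := sub_ne_zero.2 hcd
  have he0 : e ≠ 0 := by rcases he with rfl | rfl <;> simp
  have hB2 : ((Z2 + B2).card : ℝ) ≤ Γ := by
    refine le_trans (Nat.cast_le.2 ?_) h3
    refine Finset.card_le_card_of_injOn (fun v => e * (c - d) * v) ?_ ?_
    · intro v hv
      obtain ⟨x, hx, w, hw, rfl⟩ := Finset.mem_add.1 (Finset.mem_coe.1 hv)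
      obtain ⟨y, hy, rfl⟩ := Finset.mem_image.1 hw
      refine Finset.mem_coe.2 (Finset.mem_image.2 ⟨(y, x), Finset.mem_product.2 ⟨hy, hx⟩, ?_⟩)
      simp only
      linear_combination (-r * (c-d) * y) * hee - y * hr
    · intro v _ v' _ heq
      exact mul_left_cancel₀ (mul_ne_zero he0 hne) heq
  have hB1 : ∀ X1 ⊆ Z2, ((X1 + B1).card : ℝ) ≤ S := by
    intro X1 hX1
    refine le_trans (Nat.cast_le.2 (Finset.card_le_card ?_)) hAe
    exact Finset.add_subset_add (hX1.trans (hZ2.trans hX))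
      (Finset.image_subset_image (hZ1.trans hY))
  have hΓ0 : 0 ≤ Γ := le_trans (Nat.cast_nonneg _) hB2
  have hκ : (0 : ℝ) < X.card / 4 := by positivity
  obtain ⟨X'', k1, k2, k3⟩ := union_pieces (B1 + B2) (X.card / 4)
    (4 * S * Γ / (X.card / 4) ^ 2) (by positivity) hκ _ Z2 le_rfl (by
      intro X1 hX1 hX1c
      have hX1ne : X1.Nonempty := Finset.card_pos.1 (by
        have := hκ.trans hX1c
        exact_mod_cast this)
      obtain ⟨X', p1, p2, p3⟩ := two_summand X1 B1 B2 hX1ne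
      refine ⟨X', p1, p2, ?_⟩
      rw [div_mul_eq_mul_div, le_div_iff₀ (by positivity)]
      have q2 : ((X1 + B2).card : ℝ) ≤ Γ :=
        le_trans (Nat.cast_le.2 (Finset.card_le_card (Finset.add_subset_add_right hX1))) hB2
      calc ((X' + (B1 + B2)).card : ℝ) * (X.card / 4) ^ 2
          ≤ ((X' + (B1 + B2)).card : ℝ) * X1.card ^ 2 := by gcongr
        _ ≤ 4 * ((X1 + B1).card : ℝ) * ((X1 + B2).card : ℝ) * (X'.card : ℝ) := p3
        _ ≤ 4 * S * Γ * X'.card := by gcongr; exact hB1 X1 hX1)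
  have c3 : ((Z2 \ X'').card : ℝ) + X''.card = Z2.card := by
    exact_mod_cast Finset.card_sdiff_add_card_eq_card k1
  have hX''pos : (0 : ℝ) < X''.card := by linarith
  have hlow : ((X''.card * Z1.card : ℕ) : ℝ) ≤ (X'' + (B1 + B2)).card := by
    refine Nat.cast_le.2 ?_
    rw [← Finset.card_product]
    refine Finset.card_le_card_of_injOn (fun p : F × F => p.1 + e * (1 + r) * p.2) ?_ ?_
    · rintro ⟨x, y⟩ hp
      obtain ⟨hx, hy⟩ := Finset.mem_product.1 (Finset.mem_coe.1 hp)
      have : x + e * (1 + r) * y = x + (e * y + e * r * y) := by ring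
      simp only [this]
      exact Finset.mem_coe.2 (Finset.add_mem_add hx (Finset.add_mem_add
        (Finset.mem_image_of_mem _ hy) (Finset.mem_image_of_mem _ hy)))
    · exact hinj.mono (Finset.coe_subset.2
        (Finset.product_subset_product (k1.trans hZ2) hZ1))
  have hup := hlow.trans k3
  push_cast at hup
  rw [mul_comm (X''.card : ℝ)] at hup
  have hup2 : (Z1.card : ℝ) ≤ 4 * S * Γ / (X.card / 4) ^ 2 := le_of_mul_le_mul_right hup hX''pos
  rw [le_div_iff₀ (by positivity)] at hup2
  have e3 : Γ = 64 * S ^ 3 * Q / N ^ 3 := by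
    rw [hΓ]; field_simp; ring
  have e4 : Γ * N ^ 3 = 64 * S ^ 3 * Q := by
    rw [e3]; field_simp
  have hZ1c : (Y.card : ℝ) / 2 ≤ Z1.card := by linarith
  have := mul_le_mul_of_nonneg_right
    ((mul_le_mul_of_nonneg_right hZ1c (by positivity : (0:ℝ) ≤ ((X.card:ℝ) / 4) ^ 2)).trans hup2)
    (by positivity : (0:ℝ) ≤ N ^ 3)
  have e5 : 4 * S * Γ * N ^ 3 = 256 * S ^ 4 * Q := by
    calc 4 * S * Γ * N ^ 3 = 4 * S * (Γ * N ^ 3) := by ring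
      _ = _ := by rw [e4]; ring
  rw [e5] at this
  linarith

/-- elements `x` of `A` with `ξ x ∈ A` -/
def Pr (A : Finset F) (ξ : F) : Finset F := A.filter fun x => ξ * x ∈ A

/-- the dyadic level condition -/
def lev (A : Finset F) (N : ℕ) (ξ : F) : Prop := N ≤ (Pr A ξ).card ∧ (Pr A ξ).card < 2 * N

/-- pairs with popular ratio -/
def PP (A : Finset F) (N : ℕ) : Finset (F × F) := (A ×ˢ A).filter fun p => lev A N (p.2 / p.1)

lemma Pr_inv {A : Finset F} {ξ : F} (hξ : ξ ≠ 0) : (Pr A ξ⁻¹).card = (Pr A ξ).card := by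
  refine (Finset.card_bij (fun x _ => ξ * x) ?_ ?_ ?_).symm
  · intro x hx
    obtain ⟨h1, h2⟩ := Finset.mem_filter.1 hx
    exact Finset.mem_filter.2 ⟨h2, by rwa [inv_mul_cancel_left₀ hξ]⟩
  · intro x _ y _ h
    exact mul_left_cancel₀ hξ h
  · intro y hy
    obtain ⟨h1, h2⟩ := Finset.mem_filter.1 hy
    refine ⟨ξ⁻¹ * y, Finset.mem_filter.2 ⟨h2, ?_⟩, ?_⟩
    · rwa [mul_inv_cancel_left₀ hξ]
    · rw [mul_inv_cancel_left₀ hξ]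

lemma lev_inv {A : Finset F} {N : ℕ} {ξ : F} (hξ : ξ ≠ 0) (h : lev A N ξ) : lev A N ξ⁻¹ := by
  unfold lev at *
  rwa [Pr_inv hξ]

lemma pivot_count {A : Finset F} (h0 : (0 : F) ∉ A) {N : ℕ} {u : F} (hu : u ∈ A) :
    N * (A.filter fun w => (u, w) ∈ PP A N).card ≤
      ((PP A N).filter fun p => p.2 / p.1 * u ∈ A).card := by
  have hu0 : u ≠ 0 := fun h => h0 (h ▸ hu)
  have h1 : N * (A.filter fun w => (u, w) ∈ PP A N).card ≤
      ((A.filter fun w => (u, w) ∈ PP A N).sigma fun w => Pr A (w / u)).card := by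
    rw [Finset.card_sigma, mul_comm, ← smul_eq_mul, ← Finset.sum_const]
    refine Finset.sum_le_sum fun w hw => ?_
    exact (Finset.mem_filter.1 (Finset.mem_filter.1 hw).2).2.1
  refine h1.trans ?_
  refine Finset.card_le_card_of_injOn (fun s => (s.2, s.1 / u * s.2)) ?_ ?_
  · rintro ⟨w, x⟩ hs
    obtain ⟨hw, hx⟩ := Finset.mem_sigma.1 (Finset.mem_coe.1 hs)
    simp only at hw hx
    obtain ⟨hw1, hw2⟩ := Finset.mem_filter.1 hw
    obtain ⟨hx1, hx2⟩ := Finset.mem_filter.1 hx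
    have hx0 : x ≠ 0 := fun h => h0 (h ▸ hx1)
    have e1 : w / u * x / x = w / u := by field_simp
    refine Finset.mem_coe.2 (Finset.mem_filter.2 ⟨Finset.mem_filter.2
      ⟨Finset.mem_product.2 ⟨hx1, hx2⟩, ?_⟩, ?_⟩)
    · simp only [e1]
      exact (Finset.mem_filter.1 hw2).2
    · simp only [e1]
      rwa [div_mul_cancel₀ _ hu0]
  · rintro ⟨w, x⟩ hs ⟨w', x'⟩ hs' heq
    obtain ⟨hw, hx⟩ := Finset.mem_sigma.1 (Finset.mem_coe.1 hs)
    simp only at hx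
    have hx0 : x ≠ 0 := fun h => h0 (h ▸ (Finset.mem_filter.1 hx).1)
    simp only [Prod.mk.injEq] at heq
    obtain ⟨rfl, h2⟩ := heq
    have h3 := mul_right_cancel₀ hx0 h2
    have : w = w' := by
      rw [div_left_inj' hu0] at h3; exact h3
    subst this; rfl

lemma pivot {A : Finset F} (h0 : (0 : F) ∉ A) {N : ℕ} (hN : 0 < N) (hP : 0 < (PP A N).card) :
    ∃ x0 ∈ A, ∃ y0 ∈ A, ∃ X ⊆ A, ∃ Z ⊆ A,
      ((PP A N).card : ℝ) ≤ 2 * A.card * X.card ∧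
      ((PP A N).card : ℝ) ^ 2 ≤ 16 * (A.card : ℝ) ^ 3 * Z.card ∧
      (∀ z ∈ Z, lev A N (z / x0) ∧
        (N : ℝ) * (PP A N).card ≤ 8 * (A.card : ℝ) ^ 2 * ((Pr A (z / x0)) ∩ X).card) ∧
      (∀ x ∈ X, lev A N (y0 / x)) := by
  set P := PP A N with hPd
  set p : ℝ := (P.card : ℝ) with hp
  set m : ℝ := (A.card : ℝ) with hm
  have hPpos : 0 < p := by rw [hp]; exact_mod_cast hP
  have hPsub : P ⊆ A ×ˢ A := Finset.filter_subset _ _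
  have hA : A.Nonempty := by
    obtain ⟨x, hx⟩ := Finset.card_pos.1 hP
    exact ⟨x.1, (Finset.mem_product.1 (hPsub hx)).1⟩
  have hmpos : 0 < m := by rw [hm]; exact_mod_cast hA.card_pos
  have hNpos : (0 : ℝ) < N := by exact_mod_cast hN
  let B : F → Finset F := fun y => A.filter fun x => (x, y) ∈ P
  let D : F → Finset F := fun x => A.filter fun y => (x, y) ∈ P
  have sB : ∑ y ∈ A, ((B y).card : ℝ) = p := by
    rw [hp, ← Nat.cast_sum]
    congr 1
    rw [Finset.card_eq_sum_card_fiberwise (f := Prod.snd) (t := A)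
      (fun q hq => (Finset.mem_product.1 (hPsub hq)).2)]
    refine Finset.sum_congr rfl fun y hy => ?_
    refine Finset.card_bij (fun x _ => (x, y)) ?_ ?_ ?_
    · intro x hx
      exact Finset.mem_filter.2 ⟨(Finset.mem_filter.1 hx).2, rfl⟩
    · intro x _ x' _ h
      exact (Prod.mk.inj h).1
    · rintro ⟨x, y'⟩ hx
      obtain ⟨h1, h2⟩ := Finset.mem_filter.1 hx
      simp only at h2
      subst h2
      exact ⟨x, Finset.mem_filter.2 ⟨(Finset.mem_product.1 (hPsub h1)).1, h1⟩, rfl⟩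
  have sD : ∑ x ∈ A, ((D x).card : ℝ) = p := by
    rw [hp, ← Nat.cast_sum]
    congr 1
    rw [Finset.card_eq_sum_card_fiberwise (f := Prod.fst) (t := A)
      (fun q hq => (Finset.mem_product.1 (hPsub hq)).1)]
    refine Finset.sum_congr rfl fun y hy => ?_
    refine Finset.card_bij (fun x _ => (y, x)) ?_ ?_ ?_
    · intro x hx
      exact Finset.mem_filter.2 ⟨(Finset.mem_filter.1 hx).2, rfl⟩
    · intro x _ x' _ h
      exact (Prod.mk.inj h).2
    · rintro ⟨y', x⟩ hx
      obtain ⟨h1, h2⟩ := Finset.mem_filter.1 hx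
      simp only at h2
      subst h2
      exact ⟨x, Finset.mem_filter.2 ⟨(Finset.mem_product.1 (hPsub h1)).2, h1⟩, rfl⟩
  let Y : Finset F := A.filter fun y => p ≤ 2 * m * ((B y).card : ℝ)
  have hYsub : Y ⊆ A := Finset.filter_subset _ _
  have sY : p / 2 ≤ ∑ y ∈ Y, ((B y).card : ℝ) := by
    have h1 := Finset.sum_filter_add_sum_filter_not A
      (fun y => p ≤ 2 * m * ((B y).card : ℝ)) (fun y => ((B y).card : ℝ))
    rw [sB] at h1
    have h2 : ∑ y ∈ A.filter (fun y => ¬ p ≤ 2 * m * ((B y).card : ℝ)), ((B y).card : ℝ)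
        ≤ ∑ y ∈ A.filter (fun y => ¬ p ≤ 2 * m * ((B y).card : ℝ)), p / (2 * m) := by
      refine Finset.sum_le_sum fun y hy => ?_
      have := (Finset.mem_filter.1 hy).2
      push Not at this
      rw [le_div_iff₀ (by positivity)]
      linarith
    rw [Finset.sum_const, nsmul_eq_mul] at h2
    have h3 : ((A.filter (fun y => ¬ p ≤ 2 * m * ((B y).card : ℝ))).card : ℝ) ≤ m :=
      Nat.cast_le.2 (Finset.card_filter_le _ _)
    have h4 : ((A.filter (fun y => ¬ p ≤ 2 * m * ((B y).card : ℝ))).card : ℝ) * (p / (2 * m))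
        ≤ m * (p / (2 * m)) := by gcongr
    have h5 : m * (p / (2 * m)) = p / 2 := by field_simp
    linarith
  -- the sum over `u` of popular fibres
  have sDY : ∑ u ∈ A, (((D u) ∩ Y).card : ℝ) = ∑ y ∈ Y, ((B y).card : ℝ) := by
    have h1 : ∀ u ∈ A, (((D u) ∩ Y).card : ℝ) = ∑ y ∈ Y, if (u, y) ∈ P then (1 : ℝ) else 0 := by
      intro u _
      rw [Finset.sum_boole]
      congr 2
      ext y
      simp only [D, Finset.mem_inter, Finset.mem_filter]
      constructor
      · rintro ⟨⟨_, h2⟩, h3⟩; exact ⟨h3, h2⟩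
      · rintro ⟨h3, h2⟩; exact ⟨⟨hYsub h3, h2⟩, h3⟩
    have h2 : ∀ y ∈ Y, ((B y).card : ℝ) = ∑ u ∈ A, if (u, y) ∈ P then (1 : ℝ) else 0 := by
      intro y _
      rw [Finset.sum_boole]
    rw [Finset.sum_congr rfl h1, Finset.sum_congr rfl h2, Finset.sum_comm]
  have cs : (p / 2) ^ 2 ≤ m * ∑ u ∈ A, (((D u) ∩ Y).card : ℝ) ^ 2 := by
    have h1 : (∑ u ∈ A, (((D u) ∩ Y).card : ℝ)) ^ 2
        ≤ m * ∑ u ∈ A, (((D u) ∩ Y).card : ℝ) ^ 2 := sq_sum_le_card_mul_sum_sq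
    rw [sDY] at h1
    refine le_trans ?_ h1
    gcongr
  -- the main count
  have total : ∑ q ∈ A ×ˢ Y, ∑ z ∈ D q.1, (((Pr A (z / q.1)) ∩ B q.2).card : ℝ)
      = ∑ u ∈ A, (((D u) ∩ Y).card : ℝ) * ((P.filter fun p => p.2 / p.1 * u ∈ A).card : ℝ) := by
    have h1 : ∀ x0 y0 z : F, (((Pr A (z / x0)) ∩ B y0).card : ℝ)
        = ∑ u ∈ A, (if (u, y0) ∈ P then (1 : ℝ) else 0) * (if z / x0 * u ∈ A then 1 else 0) := by
      intro x0 y0 z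
      have h : ∀ u : F, (if (u, y0) ∈ P then (1 : ℝ) else 0) * (if z / x0 * u ∈ A then 1 else 0)
          = if (u, y0) ∈ P ∧ z / x0 * u ∈ A then (1 : ℝ) else 0 := by
        intro u
        by_cases h1 : (u, y0) ∈ P <;> by_cases h2 : z / x0 * u ∈ A <;> simp [h1, h2]
      simp_rw [h]
      rw [Finset.sum_boole]
      congr 2
      ext u
      simp only [Pr, B, Finset.mem_inter, Finset.mem_filter]
      tauto
    have h2 : ∀ u ∈ A, (((D u) ∩ Y).card : ℝ) = ∑ y ∈ Y, if (u, y) ∈ P then (1 : ℝ) else 0 := by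
      intro u _
      rw [Finset.sum_boole]
      congr 2
      ext y
      simp only [D, Finset.mem_inter, Finset.mem_filter]
      constructor
      · rintro ⟨⟨_, h2⟩, h3⟩; exact ⟨h3, h2⟩
      · rintro ⟨h3, h2⟩; exact ⟨⟨hYsub h3, h2⟩, h3⟩
    have h3 : ∀ u : F, ((P.filter fun p => p.2 / p.1 * u ∈ A).card : ℝ)
        = ∑ x0 ∈ A, ∑ z ∈ D x0, if z / x0 * u ∈ A then (1 : ℝ) else 0 := by
      intro u
      rw [← Finset.sum_boole, Finset.sum_sigma']
      refine (Finset.sum_bij (fun s _ => (s.1, s.2)) ?_ ?_ ?_ ?_).symm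
      · rintro ⟨a, b⟩ hs
        exact (Finset.mem_filter.1 (Finset.mem_sigma.1 hs).2).2
      · rintro ⟨a, b⟩ _ ⟨a', b'⟩ _ h
        simp only [Prod.mk.injEq] at h
        obtain ⟨rfl, rfl⟩ := h; rfl
      · rintro ⟨a, b⟩ hab
        have := Finset.mem_product.1 (hPsub hab)
        exact ⟨⟨a, b⟩, Finset.mem_sigma.2 ⟨this.1, Finset.mem_filter.2 ⟨this.2, hab⟩⟩, rfl⟩
      · intro s _; rfl
    simp_rw [h1]
    rw [Finset.sum_product]
    have h4 : ∀ u ∈ A, (((D u) ∩ Y).card : ℝ) *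
        ((P.filter fun p => p.2 / p.1 * u ∈ A).card : ℝ) =
        ∑ x0 ∈ A, ∑ y ∈ Y, ∑ z ∈ D x0, (if (u, y) ∈ P then (1 : ℝ) else 0) *
          (if z / x0 * u ∈ A then (1 : ℝ) else 0) := by
      intro u hu
      rw [h2 u hu, h3 u, Finset.sum_mul_sum, Finset.sum_comm]
      refine Finset.sum_congr rfl fun x0 _ => Finset.sum_congr rfl fun y _ => ?_
      rw [Finset.mul_sum]
    symm
    rw [Finset.sum_congr rfl h4, Finset.sum_comm]
    refine Finset.sum_congr rfl fun x0 _ => ?_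
    rw [Finset.sum_comm]
    refine Finset.sum_congr rfl fun y _ => ?_
    exact Finset.sum_comm
  have lower : (N : ℝ) * p ^ 2 / (4 * m) ≤
      ∑ q ∈ A ×ˢ Y, ∑ z ∈ D q.1, (((Pr A (z / q.1)) ∩ B q.2).card : ℝ) := by
    rw [total]
    have h1 : ∀ u ∈ A, (N : ℝ) * (((D u) ∩ Y).card : ℝ) ^ 2 ≤
        (((D u) ∩ Y).card : ℝ) * ((P.filter fun p => p.2 / p.1 * u ∈ A).card : ℝ) := by
      intro u hu
      have h2 := pivot_count h0 (N := N) hu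
      have h3 : (N : ℝ) * (D u).card ≤ ((P.filter fun p => p.2 / p.1 * u ∈ A).card : ℝ) := by
        exact_mod_cast h2
      have h4 : (((D u) ∩ Y).card : ℝ) ≤ (D u).card :=
        Nat.cast_le.2 (Finset.card_le_card Finset.inter_subset_left)
      calc (N : ℝ) * (((D u) ∩ Y).card : ℝ) ^ 2
          = (((D u) ∩ Y).card : ℝ) * (N * ((D u) ∩ Y).card) := by ring
        _ ≤ (((D u) ∩ Y).card : ℝ) * (N * (D u).card) := by gcongr
        _ ≤ _ := by gcongr
    refine le_trans ?_ (Finset.sum_le_sum h1)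
    rw [← Finset.mul_sum, div_le_iff₀ (by positivity)]
    nlinarith
  have hYne : Y.Nonempty := by
    by_contra h
    rw [Finset.not_nonempty_iff_eq_empty] at h
    rw [h] at sY
    simp at sY
    linarith
  have hYc : (Y.card : ℝ) ≤ m := Nat.cast_le.2 (Finset.card_le_card hYsub)
  set N' : ℝ := N * p / (8 * m ^ 2) with hN'
  have hN'0 : 0 ≤ N' := by positivity
  obtain ⟨⟨x0, y0⟩, hq, hbig⟩ := Finset.exists_le_of_sum_le (s := A ×ˢ Y) (hA.product hYne)
    (f := fun q => N' * ((D q.1).card : ℝ) + N * p ^ 2 / (8 * m ^ 3))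
    (g := fun q => ∑ z ∈ D q.1, (((Pr A (z / q.1)) ∩ B q.2).card : ℝ)) (by
      refine le_trans ?_ lower
      rw [Finset.sum_add_distrib, Finset.sum_const, nsmul_eq_mul, Finset.card_product,
        Finset.sum_product]
      simp only [Finset.sum_const, nsmul_eq_mul]
      rw [← Finset.mul_sum, ← Finset.mul_sum, sD]
      push_cast
      calc (Y.card : ℝ) * (N' * p) + m * Y.card * (N * p ^ 2 / (8 * m ^ 3))
          ≤ m * (N' * p) + m * m * (N * p ^ 2 / (8 * m ^ 3)) := by gcongr
        _ = N * p ^ 2 / (4 * m) := by rw [hN']; field_simp; ring)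
  simp only at hbig
  obtain ⟨hx0, hy0⟩ := Finset.mem_product.1 hq
  simp only at hx0 hy0
  let Z := (D x0).filter fun z => N' ≤ (((Pr A (z / x0)) ∩ B y0).card : ℝ)
  have hlev : ∀ z ∈ D x0, lev A N (z / x0) := fun z hz =>
    (Finset.mem_filter.1 (Finset.mem_filter.1 hz).2).2
  refine ⟨x0, hx0, y0, hYsub hy0, B y0, Finset.filter_subset _ _, Z,
    (Finset.filter_subset _ _).trans (Finset.filter_subset _ _), (Finset.mem_filter.1 hy0).2,
    ?_, ?_, ?_⟩
  · have h1 : ∑ z ∈ D x0, (((Pr A (z / x0)) ∩ B y0).card : ℝ)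
        ≤ 2 * N * Z.card + N' * (D x0).card := by
      rw [← Finset.sum_filter_add_sum_filter_not (D x0)
        (fun z => N' ≤ (((Pr A (z / x0)) ∩ B y0).card : ℝ))]
      refine add_le_add ?_ ?_
      · rw [mul_comm, ← nsmul_eq_mul, ← Finset.sum_const]
        refine Finset.sum_le_sum fun z hz => ?_
        have h2 := (hlev z (Finset.mem_filter.1 hz).1).2
        have h3 := Finset.card_le_card (Finset.inter_subset_left (s₁ := Pr A (z / x0)) (s₂ := B y0))
        exact_mod_cast (h3.trans h2.le)
      · refine le_trans (Finset.sum_le_sum (g := fun _ => N') fun z hz => ?_) ?_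
        · have := (Finset.mem_filter.1 hz).2
          push Not at this
          exact this.le
        · rw [Finset.sum_const, nsmul_eq_mul, mul_comm]
          gcongr
          exact Finset.filter_subset _ _
    have h2 : (N : ℝ) * p ^ 2 / (8 * m ^ 3) ≤ 2 * N * Z.card := by linarith
    rw [div_le_iff₀ (by positivity)] at h2
    have h3 : (N : ℝ) * p ^ 2 ≤ N * (16 * m ^ 3 * Z.card) := by linarith
    exact le_of_mul_le_mul_left h3 hNpos
  · intro z hz
    obtain ⟨h1, h2⟩ := Finset.mem_filter.1 hz
    refine ⟨hlev z h1, ?_⟩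
    rw [hN', div_le_iff₀ (by positivity)] at h2
    linarith
  · intro x hx
    exact (Finset.mem_filter.1 (Finset.mem_filter.1 hx).2).2

lemma inj_of_not_quot {X : Finset F} {s : F} (hs : s ∉ quotSet X) :
    Set.InjOn (fun p : F × F => p.1 + s * p.2) (X ×ˢ X : Finset (F × F)) := by
  rintro ⟨x1, y1⟩ h1 ⟨x2, y2⟩ h2 heq
  obtain ⟨hx1, hy1⟩ := Finset.mem_product.1 (Finset.mem_coe.1 h1)
  obtain ⟨hx2, hy2⟩ := Finset.mem_product.1 (Finset.mem_coe.1 h2)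
  simp only at heq hx1 hx2 hy1 hy2
  by_cases hy : y1 = y2
  · subst hy
    have := add_right_cancel heq
    rw [this]
  · exfalso
    apply hs
    refine ⟨x2, hx2, x1, hx1, y1, hy1, y2, hy2, hy, ?_⟩
    rw [eq_div_iff (sub_ne_zero.2 hy)]
    linear_combination heq

lemma quot_neg {X : Finset F} {s : F} (hs : s ∈ quotSet X) : -s ∈ quotSet X := by
  obtain ⟨x1, h1, x2, h2, x3, h3, x4, h4, hne, rfl⟩ := hs
  exact ⟨x2, h2, x1, h1, x3, h3, x4, h4, hne, by rw [← neg_div]; ring⟩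

lemma quot_zero {X : Finset F} {s : F} (hs : s ∈ quotSet X) : (0 : F) ∈ quotSet X := by
  obtain ⟨x1, h1, x2, h2, x3, h3, x4, h4, hne, rfl⟩ := hs
  exact ⟨x1, h1, x1, h1, x3, h3, x4, h4, hne, by simp⟩

lemma quot_card {X : Finset F} (hs : quotSet X = ∅) : X.card ≤ 1 := by
  by_contra h
  push Not at h
  obtain ⟨a, ha, b, hb, hab⟩ := Finset.one_lt_card.1 h
  have : (a - a) / (a - b) ∈ quotSet X := ⟨a, ha, a, ha, a, ha, b, hb, hab, rfl⟩
  rw [hs] at this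
  exact this

lemma subfield_of_closed [Fintype F] {Z : Finset F} {x0 : F} (hx0 : x0 ≠ 0)
    (hZ0 : ∀ z ∈ Z, z ≠ 0) (hne : (quotSet Z).Nonempty)
    (hplus : ∀ r ∈ quotSet Z, r + 1 ∈ quotSet Z)
    (hmul : ∀ r ∈ quotSet Z, ∀ z ∈ Z, r * (z / x0) ∈ quotSet Z) :
    ∃ G : Subfield F, ∀ r, r ∈ G ↔ r ∈ quotSet Z := by
  set R := quotSet Z with hR
  have hinv : ∀ t : F, t ≠ 0 → t⁻¹ = t ^ (Fintype.card F - 2) := by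
    intro t ht
    have h1 := FiniteField.pow_card_sub_one_eq_one t ht
    have h2 : 2 ≤ Fintype.card F := Fintype.one_lt_card
    have h3 : Fintype.card F - 1 = (Fintype.card F - 2) + 1 := by omega
    rw [h3, pow_succ] at h1
    exact (eq_inv_of_mul_eq_one_left h1).symm
  have h0R : (0 : F) ∈ R := by
    obtain ⟨r, hr⟩ := hne
    exact quot_zero hr
  let Ad : F → Prop := fun g => ∀ r ∈ R, r + g ∈ R
  have Ad0 : Ad 0 := fun r hr => by simpa using hr
  have Ad1 : Ad 1 := hplus
  have Adadd : ∀ g g', Ad g → Ad g' → Ad (g + g') := fun g g' h h' r hr => by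
    rw [← add_assoc]; exact h' _ (h _ hr)
  have Adneg : ∀ g, Ad g → Ad (-g) := fun g h r hr => by
    have := quot_neg (h _ (quot_neg hr))
    have e : -(-r + g) = r + -g := by ring
    rwa [e] at this
  let T : Subring F :=
    { carrier := {t | ∀ g, Ad g → Ad (g * t)}
      mul_mem' := fun {a b} ha hb g hg => by rw [← mul_assoc]; exact hb _ (ha _ hg)
      one_mem' := fun g hg => by rwa [mul_one]
      add_mem' := fun {a b} ha hb g hg => by rw [mul_add]; exact Adadd _ _ (ha g hg) (hb g hg)
      zero_mem' := fun g _ => by rw [mul_zero]; exact Ad0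
      neg_mem' := fun {a} ha g hg => by rw [mul_neg]; exact Adneg _ (ha g hg) }
  have hw : ∀ z ∈ Z, z / x0 ∈ T := by
    intro z hz g hg r hr
    have hw0 : z / x0 ≠ 0 := div_ne_zero (hZ0 z hz) hx0
    have hpow : ∀ n : ℕ, ∀ r ∈ R, r * (z / x0) ^ n ∈ R := by
      intro n
      induction n with
      | zero => intro r hr; simpa using hr
      | succ n ih => intro r hr; rw [pow_succ, ← mul_assoc]; exact hmul _ (ih r hr) z hz
    have h1 : r * (z / x0)⁻¹ ∈ R := by rw [hinv _ hw0]; exact hpow _ r hr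
    have h2 := hmul _ (hg _ h1) z hz
    have e : (r * (z / x0)⁻¹ + g) * (z / x0) = r + g * (z / x0) := by
      rw [add_mul, inv_mul_cancel_right₀ hw0]
    rwa [e] at h2
  have hTinv : ∀ t ∈ T, t⁻¹ ∈ T := by
    intro t ht
    by_cases h : t = 0
    · subst h; simp
    · rw [hinv t h]; exact T.pow_mem ht _
  let G : Subfield F := { T with inv_mem' := hTinv }
  refine ⟨G, fun r => ⟨fun hr => ?_, fun hr => ?_⟩⟩
  · have hr' : r ∈ T := hr
    have := hr' 1 Ad1 0 h0R
    simpa using this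
  · obtain ⟨x1, h1, x2, h2, x3, h3, x4, h4, hne, rfl⟩ := hr
    have e : (x1 - x2) / (x3 - x4) = (x1 / x0 - x2 / x0) / (x3 / x0 - x4 / x0) := by
      rw [← sub_div, ← sub_div, div_div_div_cancel_right₀ hx0]
    rw [e]
    have g : ∀ z ∈ Z, z / x0 ∈ G := hw
    exact G.div_mem (G.sub_mem (g _ h1) (g _ h2)) (G.sub_mem (g _ h3) (g _ h4))

lemma exists_inj_subset {α β : Type*} (s : Finset α) (f : α → β) :
    ∃ W ⊆ s, W.card = (s.image f).card ∧ Set.InjOn f W := by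
  rcases s.eq_empty_or_nonempty with rfl | ⟨a0, ha0⟩
  · exact ⟨∅, by simp, by simp, by simp⟩
  have : Nonempty α := ⟨a0⟩
  have h : ∀ b ∈ s.image f, ∃ a ∈ s, f a = b := fun b hb => Finset.mem_image.1 hb
  choose! g hg1 hg2 using h
  refine ⟨(s.image f).image g, ?_, ?_, ?_⟩
  · intro a ha
    obtain ⟨b, hb, rfl⟩ := Finset.mem_image.1 ha
    exact hg1 b hb
  · refine Finset.card_image_of_injOn ?_
    intro b hb b' hb' h
    rw [← hg2 b hb, ← hg2 b' hb', h]
  · intro a ha a' ha' h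
    obtain ⟨b, hb, rfl⟩ := Finset.mem_image.1 (Finset.mem_coe.1 ha)
    obtain ⟨b', hb', rfl⟩ := Finset.mem_image.1 (Finset.mem_coe.1 ha')
    rw [hg2 b hb, hg2 b' hb'] at h
    rw [h]

lemma spread (X G : Finset F) (hG : X.card ^ 2 ≤ G.card) (hX : X.Nonempty) :
    ∃ r ∈ G, ∃ W ⊆ X ×ˢ X, (X.card : ℝ) ^ 2 ≤ 4 * W.card ∧
      Set.InjOn (fun p : F × F => p.1 + r * p.2) W := by
  have hXp := hX.card_pos
  have hGp : 0 < G.card := lt_of_lt_of_le (by positivity) hG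
  let P := X ×ˢ X
  let En : F → ℕ := fun r =>
    ((P ×ˢ P).filter fun t => t.1.1 + r * t.1.2 = t.2.1 + r * t.2.2).card
  have hsum : ∑ r ∈ G, En r ≤ G.card * X.card ^ 2 + X.card ^ 4 := by
    have h1 : ∑ r ∈ G, En r = ∑ t ∈ P ×ˢ P,
        (G.filter fun r => t.1.1 + r * t.1.2 = t.2.1 + r * t.2.2).card := by
      simp only [En, Finset.card_filter]
      exact Finset.sum_comm
    rw [h1]
    have h2 : ∀ t ∈ P ×ˢ P, (G.filter fun r => t.1.1 + r * t.1.2 = t.2.1 + r * t.2.2).card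
        ≤ (if t.1 = t.2 then G.card else 0) + 1 := by
      rintro ⟨⟨a, b⟩, ⟨c, d⟩⟩ _
      by_cases h : ((a, b) : F × F) = (c, d)
      · simp only [h, if_true]
        exact (Finset.card_filter_le _ _).trans (Nat.le_succ _)
      · simp only [h, if_false, zero_add]
        rw [Finset.card_le_one]
        intro r hr r' hr'
        have e1 := (Finset.mem_filter.1 hr).2
        have e2 := (Finset.mem_filter.1 hr').2
        by_cases hbd : b = d
        · subst hbd
          exact absurd (by rw [add_right_cancel e1]) h
        · have : (r - r') * (b - d) = 0 := by linear_combination e1 - e2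
          rcases mul_eq_zero.1 this with h' | h'
          · exact sub_eq_zero.1 h'
          · exact absurd (sub_eq_zero.1 h') hbd
    refine (Finset.sum_le_sum h2).trans ?_
    rw [Finset.sum_add_distrib, Finset.sum_product]
    have h3 : ∀ x ∈ P, ∑ y ∈ P, (if ((x, y) : (F × F) × (F × F)).1 = (x, y).2 then G.card else 0)
        = G.card := by
      intro x hx
      simp [hx]
    rw [Finset.sum_congr rfl h3]
    simp only [Finset.sum_const, smul_eq_mul, P, Finset.card_product]
    apply le_of_eq; ring
  obtain ⟨r, hr, hEr⟩ : ∃ r ∈ G, En r ≤ 2 * X.card ^ 2 := by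
    refine Finset.exists_le_of_sum_le (Finset.card_pos.1 hGp) ?_
    refine hsum.trans ?_
    rw [Finset.sum_const, smul_eq_mul]
    nlinarith
  have hcs := cs_image P (fun p : F × F => p.1 + r * p.2)
  obtain ⟨W, hW, hWc, hWi⟩ := exists_inj_subset P (fun p : F × F => p.1 + r * p.2)
  refine ⟨r, hr, W, hW, ?_, hWi⟩
  rw [← hWc] at hcs
  have h5 : P.card ^ 2 ≤ W.card * (2 * X.card ^ 2) := hcs.trans (Nat.mul_le_mul_left _ hEr)
  have h6 : P.card = X.card ^ 2 := by simp only [P, Finset.card_product]; ring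
  rw [h6] at h5
  have h7 : X.card ^ 2 * X.card ^ 2 ≤ (2 * W.card) * X.card ^ 2 := by nlinarith
  have h8 : X.card ^ 2 ≤ 2 * W.card := Nat.le_of_mul_le_mul_right h7 (by positivity)
  have h9 : (X.card : ℝ) ^ 2 ≤ 2 * W.card := by exact_mod_cast h8
  have : (0 : ℝ) ≤ W.card := Nat.cast_nonneg _
  linarith

lemma subfieldCond_mem {A X : Finset F} {C β : ℝ} (h : subfieldCond A C β) (G : Subfield F)
    (hG : G ≠ ⊤) (c d : F) (hX : X ⊆ A) (hm : ∀ x ∈ X, ∃ g ∈ G, x = c * g + d) :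
    (X.card : ℝ) ≤ C * max ((Nat.card G : ℝ) ^ ((1:ℝ)/2)) β := by
  refine le_trans ?_ (h G hG c d)
  exact Nat.cast_le.2 (Finset.card_le_card fun x hx => Finset.mem_filter.2 ⟨hX hx, hm x hx⟩)

set_option maxHeartbeats 2000000 in
lemma core_cases [Fintype F] {A : Finset F} {e : F} {S Q C β : ℝ} {N : ℕ}
    (h0 : (0 : F) ∉ A) (he : e = 1 ∨ e = -1) (hS : 0 ≤ S)
    (hAe : ((A + A.image (e * ·)).card : ℝ) ≤ S)
    (hQ : ((q4 A e).card : ℝ) ≤ Q) (hN : 0 < N) (hC : 0 < C)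
    (hsub : subfieldCond A C β) (hP : 0 < (PP A N).card) :
    ∃ x z : ℝ, 0 ≤ x ∧ 0 ≤ z ∧ ((PP A N).card : ℝ) ≤ 2 * A.card * x ∧
      ((PP A N).card : ℝ) ^ 2 ≤ 16 * (A.card : ℝ) ^ 3 * z ∧
      (((PP A N).card : ℝ) ≤ 2 * A.card ∨
        x ^ 2 * (N : ℝ) ^ 4 ≤ 2 ^ 26 * (1 + C ^ 2) * (S ^ 4 * Q) ∨
        z ^ 2 * (N : ℝ) ^ 4 ≤ 2 ^ 26 * (1 + C ^ 2) * (S ^ 4 * Q) ∨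
        x ^ 2 * ((N : ℝ) * (PP A N).card) * (N : ℝ) ^ 3 ≤
          8 * (A.card : ℝ) ^ 2 * (2 ^ 26 * (1 + C ^ 2) * (S ^ 4 * Q)) ∨
        ((N : ℝ) * (PP A N).card) ^ 2 * (N : ℝ) ^ 3 ≤
          64 * (A.card : ℝ) ^ 4 * (2 ^ 26 * (1 + C ^ 2) * (S ^ 3 * Q)) ∨
        (Fintype.card F : ℝ) * (N : ℝ) ^ 4 ≤ 2 ^ 26 * (1 + C ^ 2) * (S ^ 4 * Q) ∨
        x ≤ C * β) := by
  obtain ⟨x0, hx0, y0, hy0, X, hX, Z, hZ, hpX, hpZ, hZlev, hXlev⟩ := pivot h0 hN hP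
  have hQ0 : 0 ≤ Q := le_trans (Nat.cast_nonneg _) hQ
  have hNr : (0 : ℝ) < N := by exact_mod_cast hN
  have nz : ∀ {a : F}, a ∈ A → a ≠ 0 := fun ha h => h0 (h ▸ ha)
  have hx00 := nz hx0
  have hy00 := nz hy0
  have hS4 : 0 ≤ S ^ 4 * Q := by positivity
  have hS3 : 0 ≤ S ^ 3 * Q := by positivity
  have hCC : 0 ≤ C ^ 2 := by positivity
  have hAA : ((A + A).card : ℝ) ≤ S ∨ ((A - A).card : ℝ) ≤ S := by
    rcases he with rfl | rfl
    · left
      have : A.image ((1 : F) * ·) = A := by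
        ext v; simp
      rwa [this] at hAe
    · right
      have : A.image ((-1 : F) * ·) = -A := by
        ext v
        simp only [Finset.mem_image, Finset.mem_neg, neg_mul, one_mul]
      rwa [this, ← sub_eq_add_neg] at hAe
  have gZ : ∀ z ∈ Z, Good A S N x0 z := by
    intro z hz
    refine good_of (P := Pr A (z / x0)) hNr hAA (Finset.filter_subset _ _)
      (by exact_mod_cast (hZlev z hz).1.1) fun u hu => ?_
    refine ⟨z / x0 * u, (Finset.mem_filter.1 hu).2, ?_⟩
    field_simp
  have gX : ∀ x ∈ X, Good A S N y0 x := by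
    intro x hx
    have hx' := nz (hX hx)
    have hl := lev_inv (div_ne_zero hy00 hx') (hXlev x hx)
    rw [inv_div] at hl
    refine good_of (P := Pr A (x / y0)) hNr hAA (Finset.filter_subset _ _)
      (by exact_mod_cast hl.1) fun u hu => ?_
    refine ⟨x / y0 * u, (Finset.mem_filter.1 hu).2, ?_⟩
    field_simp
  have fullW : ∀ Y : Finset F, (Y.card : ℝ) ^ 2 ≤ 4 * ((Y ×ˢ Y).card : ℝ) := by
    intro Y
    rw [Finset.card_product]; push_cast
    nlinarith [sq_nonneg (Y.card : ℝ)]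
  refine ⟨X.card, Z.card, Nat.cast_nonneg _, Nat.cast_nonneg _, hpX, hpZ, ?_⟩
  -- Case 0
  by_cases hc0 : ∃ r ∈ quotSet Z, r ∉ quotSet X
  · obtain ⟨r, ⟨a, ha, b, hb, c, hc, d, hd, hcd, rfl⟩, hrX⟩ := hc0
    right; left
    have := four_inj he hNr hS hQ hX (gZ a ha) (gZ b hb) (gZ c hc) (gZ d hd) hcd
      (div_mul_cancel₀ _ (sub_ne_zero.2 hcd)) (Finset.Subset.refl _) (fullW X)
      (inj_of_not_quot hrX)
    nlinarith
  by_cases hc0' : ∃ r ∈ quotSet X, r ∉ quotSet Z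
  · obtain ⟨r, ⟨a, ha, b, hb, c, hc, d, hd, hcd, rfl⟩, hrX⟩ := hc0'
    right; right; left
    have := four_inj he hNr hS hQ hZ (gX a ha) (gX b hb) (gX c hc) (gX d hd) hcd
      (div_mul_cancel₀ _ (sub_ne_zero.2 hcd)) (Finset.Subset.refl _) (fullW Z)
      (inj_of_not_quot hrX)
    nlinarith
  push Not at hc0 hc0'
  rcases (quotSet X).eq_empty_or_nonempty with hemp | hneX
  · left
    have h1 : (X.card : ℝ) ≤ 1 := by exact_mod_cast quot_card hemp
    have h2 : (0 : ℝ) ≤ A.card := Nat.cast_nonneg _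
    nlinarith
  have hneZ : (quotSet Z).Nonempty := by
    obtain ⟨r, hr⟩ := hneX; exact ⟨r, hc0' r hr⟩
  -- case (ii)
  by_cases hplus : ∃ r ∈ quotSet Z, r + 1 ∉ quotSet Z
  · obtain ⟨r, ⟨a, ha, b, hb, c, hc, d, hd, hcd, hrr⟩, hrX⟩ := hplus
    right; right; right; left
    have hq : e * (1 + r) ∉ quotSet X := by
      intro h
      apply hrX
      apply hc0'
      rcases he with rfl | rfl
      · rwa [one_mul, add_comm] at h
      · have := quot_neg h
        have e1 : -(-1 * (1 + r)) = r + 1 := by ring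
        rwa [e1] at this
    have := plus_inj (Y := Pr A (a / x0) ∩ X) he hNr hS hAe hQ hX
      (Finset.inter_subset_right.trans hX)
      (a := a) (lam := x0) (r := r) (fun y hy => ⟨a / x0 * y,
        (Finset.mem_filter.1 (Finset.mem_inter.1 hy).1).2, by field_simp⟩)
      (gZ b hb) (gZ c hc) (gZ d hd) hcd
      (by rw [hrr]; exact div_mul_cancel₀ _ (sub_ne_zero.2 hcd))
      ((inj_of_not_quot hq).mono (Finset.coe_subset.2
        (Finset.product_subset_product (Finset.Subset.refl _) Finset.inter_subset_right)))
    have h2 := (hZlev a ha).2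
    calc (X.card : ℝ) ^ 2 * ((N : ℝ) * (PP A N).card) * (N : ℝ) ^ 3
        ≤ (X.card : ℝ) ^ 2 * (8 * (A.card : ℝ) ^ 2 * ((Pr A (a / x0)) ∩ X).card) * (N : ℝ) ^ 3 := by
          gcongr
      _ = 8 * (A.card : ℝ) ^ 2 * ((X.card : ℝ) ^ 2 * ((Pr A (a / x0)) ∩ X).card * (N : ℝ) ^ 3) := by
          ring
      _ ≤ 8 * (A.card : ℝ) ^ 2 * (8192 * S ^ 4 * Q) := by gcongr
      _ ≤ _ := by
        refine mul_le_mul_of_nonneg_left ?_ (by positivity)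
        nlinarith
  push Not at hplus
  -- case (iii)
  by_cases hmul : ∃ r ∈ quotSet Z, ∃ z ∈ Z, r * (z / x0) ∉ quotSet Z
  · obtain ⟨r, ⟨a, ha, b, hb, c, hc, d, hd, hcd, hrr⟩, z, hz, hrX⟩ := hmul
    right; right; right; right; left
    have hq : r * (z / x0) ∉ quotSet X := fun h => hrX (hc0' _ h)
    have hw0 : z / x0 ≠ 0 := div_ne_zero (nz (hZ hz)) hx00
    have hcard : ((Pr A (z / x0) ∩ X).image ((z / x0) * ·)).card = (Pr A (z / x0) ∩ X).card :=
      Finset.card_image_of_injective _ (mul_right_injective₀ hw0)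
    have := three_inj (Y1 := Pr A (c / x0) ∩ X) (Y2 := (Pr A (z / x0) ∩ X).image ((z / x0) * ·))
      (c := c) (lam := x0) (r := r) he hNr hS hQ
      (Finset.inter_subset_right.trans hX)
      (by
        intro v hv
        obtain ⟨u, hu, rfl⟩ := Finset.mem_image.1 hv
        exact (Finset.mem_filter.1 (Finset.mem_inter.1 hu).1).2)
      (gZ a ha) (gZ b hb)
      (fun y hy => ⟨c / x0 * y,
        (Finset.mem_filter.1 (Finset.mem_inter.1 hy).1).2, by field_simp⟩)
      (gZ d hd) hcd
      (by rw [hrr]; exact div_mul_cancel₀ _ (sub_ne_zero.2 hcd))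
      (by
        rintro ⟨p1, p2⟩ hp ⟨p1', p2'⟩ hp' heq
        obtain ⟨hp1, hp2⟩ := Finset.mem_product.1 (Finset.mem_coe.1 hp)
        obtain ⟨hp1', hp2'⟩ := Finset.mem_product.1 (Finset.mem_coe.1 hp')
        obtain ⟨u, hu, hu2⟩ := Finset.mem_image.1 hp2
        obtain ⟨u', hu', hu2'⟩ := Finset.mem_image.1 hp2'
        simp only at hu2 hu2' heq
        subst hu2 hu2'
        have m1 : (p1, u) ∈ X ×ˢ X :=
          Finset.mem_product.2 ⟨(Finset.mem_inter.1 hp1).2, (Finset.mem_inter.1 hu).2⟩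
        have m2 : (p1', u') ∈ X ×ˢ X :=
          Finset.mem_product.2 ⟨(Finset.mem_inter.1 hp1').2, (Finset.mem_inter.1 hu').2⟩
        have := inj_of_not_quot hq (Finset.mem_coe.2 m1) (Finset.mem_coe.2 m2)
          (by simp only; linear_combination heq)
        simp only [Prod.mk.injEq] at this
        obtain ⟨rfl, rfl⟩ := this
        rfl)
    rw [hcard] at this
    have h1 := (hZlev c hc).2
    have h2 := (hZlev z hz).2
    have h3 : 0 ≤ (N : ℝ) * (PP A N).card := by positivity
    calc ((N : ℝ) * (PP A N).card) ^ 2 * (N : ℝ) ^ 3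
        = ((N : ℝ) * (PP A N).card) * ((N : ℝ) * (PP A N).card) * (N : ℝ) ^ 3 := by ring
      _ ≤ (8 * (A.card : ℝ) ^ 2 * ((Pr A (c / x0)) ∩ X).card) *
            (8 * (A.card : ℝ) ^ 2 * ((Pr A (z / x0)) ∩ X).card) * (N : ℝ) ^ 3 := by gcongr
      _ = 64 * (A.card : ℝ) ^ 4 * (((Pr A (c / x0)) ∩ X).card * ((Pr A (z / x0)) ∩ X).card
            * (N : ℝ) ^ 3) := by ring
      _ ≤ 64 * (A.card : ℝ) ^ 4 * (256 * S ^ 3 * Q) := by gcongr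
      _ ≤ _ := by
        refine mul_le_mul_of_nonneg_left ?_ (by positivity)
        nlinarith
  push Not at hmul
  obtain ⟨G, hG⟩ := subfield_of_closed hx00 (fun z hz => nz (hZ hz)) hneZ hplus hmul
  let Gf : Finset F := Finset.univ.filter (· ∈ G)
  have hGf : Nat.card G = Gf.card := by
    rw [Nat.card_eq_fintype_card, Fintype.card_subtype]
  have hGpos : 0 < Gf.card := Finset.card_pos.2 ⟨0, by simp [Gf]⟩
  have key : ∀ Y ⊆ X, Y.Nonempty → Y.card ^ 2 ≤ Gf.card →
      (Y.card : ℝ) ^ 2 * (N : ℝ) ^ 4 ≤ 8 * 32 ^ 4 * S ^ 4 * Q := by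
    intro Y hY hYne hYc
    obtain ⟨r, hr, W, hW, hWc, hWi⟩ := spread Y Gf hYc hYne
    have hr' : r ∈ quotSet Z := (hG r).1 (Finset.mem_filter.1 hr).2
    obtain ⟨a, ha, b, hb, c, hc, d, hd, hcd, hrr⟩ := hr'
    exact four_inj he hNr hS hQ (hY.trans hX) (gZ a ha) (gZ b hb) (gZ c hc) (gZ d hd) hcd
      (by rw [hrr]; exact div_mul_cancel₀ _ (sub_ne_zero.2 hcd)) hW hWc hWi
  obtain ⟨r0, x1, hx1, x2, hx2, x3, hx3, x4, hx4, hne34, -⟩ := hneX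
  have hXne : X.Nonempty := ⟨x1, hx1⟩
  by_cases hbig : X.card ^ 2 ≤ Gf.card
  · right; left
    have := key X (Finset.Subset.refl _) hXne hbig
    nlinarith
  have hle : Nat.sqrt Gf.card ≤ X.card := by
    by_contra h
    push Not at h
    have := Nat.sqrt_le' Gf.card
    push Not at hbig
    nlinarith
  obtain ⟨Y, hY, hYc⟩ := Finset.exists_subset_card_eq hle
  have hsq : 0 < Nat.sqrt Gf.card := Nat.sqrt_pos.2 hGpos
  have hk := key Y hY (Finset.card_pos.1 (by omega)) (by rw [hYc]; exact Nat.sqrt_le' _)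
  rw [hYc] at hk
  have hs1 : Gf.card ≤ 4 * Nat.sqrt Gf.card ^ 2 := by
    have := Nat.lt_succ_sqrt' Gf.card
    have h3 : (Nat.sqrt Gf.card).succ ≤ 2 * Nat.sqrt Gf.card := by omega
    have h4 := Nat.pow_le_pow_left h3 2
    have h5 : (2 * Nat.sqrt Gf.card) ^ 2 = 4 * Nat.sqrt Gf.card ^ 2 := by ring
    omega
  have hs2 : (Gf.card : ℝ) ≤ 4 * (Nat.sqrt Gf.card : ℝ) ^ 2 := by exact_mod_cast hs1
  have hGN : (Gf.card : ℝ) * (N : ℝ) ^ 4 ≤ 2 ^ 25 * (S ^ 4 * Q) := by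
    calc (Gf.card : ℝ) * (N : ℝ) ^ 4 ≤ 4 * (Nat.sqrt Gf.card : ℝ) ^ 2 * (N : ℝ) ^ 4 := by gcongr
      _ = 4 * ((Nat.sqrt Gf.card : ℝ) ^ 2 * (N : ℝ) ^ 4) := by ring
      _ ≤ 4 * (8 * 32 ^ 4 * S ^ 4 * Q) := by gcongr
      _ = _ := by ring
  by_cases htop : G = ⊤
  · right; right; right; right; right; left
    have : Gf.card = Fintype.card F := by
      rw [← Finset.card_univ]
      congr 1
      ext v; simp [Gf, htop]
    rw [this] at hGN
    nlinarith
  · have hXm := subfieldCond_mem hsub G htop (x3 - x4) x2 hX (by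
      intro x hx
      refine ⟨(x - x2) / (x3 - x4), (hG _).2 (hc0' _ ⟨x, hx, x2, hx2, x3, hx3, x4, hx4, hne34, rfl⟩),
        ?_⟩
      rw [mul_div_cancel₀ _ (sub_ne_zero.2 hne34)]
      ring)
    rw [hGf] at hXm
    rcases le_total ((Gf.card : ℝ) ^ ((1:ℝ)/2)) β with hmx | hmx
    · rw [max_eq_right hmx] at hXm
      right; right; right; right; right; right
      exact hXm
    · rw [max_eq_left hmx] at hXm
      right; left
      have hsq : ((Gf.card : ℝ) ^ ((1:ℝ)/2)) ^ 2 = Gf.card := by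
        rw [← Real.sqrt_eq_rpow, Real.sq_sqrt (Nat.cast_nonneg _)]
      have h1 : (X.card : ℝ) ^ 2 ≤ C ^ 2 * Gf.card := by
        calc (X.card : ℝ) ^ 2 ≤ (C * (Gf.card : ℝ) ^ ((1:ℝ)/2)) ^ 2 := by gcongr
          _ = _ := by rw [mul_pow, hsq]
      calc (X.card : ℝ) ^ 2 * (N : ℝ) ^ 4 ≤ C ^ 2 * Gf.card * (N : ℝ) ^ 4 := by gcongr
        _ = C ^ 2 * (Gf.card * (N : ℝ) ^ 4) := by ring
        _ ≤ C ^ 2 * (2 ^ 25 * (S ^ 4 * Q)) := by gcongr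
        _ ≤ _ := by nlinarith

lemma le_of_pow_le_mul {x y K : ℝ} {n : ℕ} (hn : n ≠ 0) (hK : 1 ≤ K) (hy : 0 ≤ y)
    (h : x ^ n ≤ K * y ^ n) : x ≤ K * y := by
  refine le_of_pow_le_pow_left₀ hn (by positivity) (h.trans ?_)
  rw [mul_pow]
  gcongr
  exact le_self_pow₀ hK hn

lemma core_bound [Fintype F] {A : Finset F} {e : F} {S C β ψ m0 : ℝ} {N : ℕ}
    (h0 : (0 : F) ∉ A) (he : e = 1 ∨ e = -1)
    (hAe : ((A + A.image (e * ·)).card : ℝ) ≤ S) (hmS : (A.card : ℝ) ≤ S)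
    (hQ : ((q4 A e).card : ℝ) ≤ 4096 * S ^ 3 / (A.card : ℝ) ^ 2) (hN : 0 < N) (hC : 0 < C)
    (hβ : 0 ≤ β) (hsub : subfieldCond A C β) (hm0 : (A.card : ℝ) ≤ m0) (hψ : 0 < ψ)
    (h1 : S ^ 7 ≤ ψ ^ 4) (h2 : S ^ 6 * m0 ^ 3 ≤ ψ ^ 5)
    (h3 : S ^ 7 * m0 ^ 2 ≤ Fintype.card F * ψ ^ 4) (h4 : β * m0 ≤ ψ) :
    (N : ℝ) * (PP A N).card ≤ 2 ^ 46 * (1 + C ^ 2) * (A.card * ψ) := by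
  rcases Nat.eq_zero_or_pos (PP A N).card with hz | hP
  · rw [hz]; simp; positivity
  have hS : 0 ≤ S := le_trans (Nat.cast_nonneg _) hmS
  have hPsub : PP A N ⊆ A ×ˢ A := Finset.filter_subset _ _
  have hpm : ((PP A N).card : ℝ) ≤ (A.card : ℝ) ^ 2 := by
    have := Finset.card_le_card hPsub
    rw [Finset.card_product] at this
    rw [sq]; exact_mod_cast this
  have hmpos : (1 : ℝ) ≤ A.card := by
    obtain ⟨x, hx⟩ := Finset.card_pos.1 hP
    have : 0 < A.card := Finset.card_pos.2 ⟨x.1, (Finset.mem_product.1 (hPsub hx)).1⟩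
    exact_mod_cast this
  have hNm : (N : ℝ) ≤ A.card := by
    obtain ⟨x, hx⟩ := Finset.card_pos.1 hP
    have := (Finset.mem_filter.1 hx).2.1
    exact_mod_cast this.trans (Finset.card_filter_le _ _)
  have hNr : (0 : ℝ) < N := by exact_mod_cast hN
  have hPr : (0 : ℝ) < (PP A N).card := by exact_mod_cast hP
  obtain ⟨x, z, hx, hz, hpx, hpz, hcases⟩ := core_cases h0 he hS hAe hQ hN hC hsub hP
  have hq : (0 : ℝ) < Fintype.card F := by exact_mod_cast Fintype.card_pos
  generalize ((PP A N).card : ℝ) = p at *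
  generalize (A.card : ℝ) = m at *
  generalize (N : ℝ) = n at *
  generalize (Fintype.card F : ℝ) = q at *
  have hm : 0 < m := by linarith
  have hm00 : 0 ≤ m0 := by linarith
  set D : ℝ := 1 + C ^ 2 with hD
  have hD1 : 1 ≤ D := by rw [hD]; nlinarith [sq_nonneg C]
  have hQ4 : m ^ 2 * (2 ^ 26 * D * (S ^ 4 * (4096 * S ^ 3 / m ^ 2))) = 2 ^ 38 * D * S ^ 7 := by
    field_simp; ring
  have hQ3 : m ^ 2 * (2 ^ 26 * D * (S ^ 3 * (4096 * S ^ 3 / m ^ 2))) = 2 ^ 38 * D * S ^ 6 := by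
    field_simp; ring
  generalize 2 ^ 26 * D * (S ^ 4 * (4096 * S ^ 3 / m ^ 2)) = U at *
  generalize 2 ^ 26 * D * (S ^ 3 * (4096 * S ^ 3 / m ^ 2)) = V at *
  have hK1 : (1 : ℝ) ≤ 2 ^ 46 * D := by linarith
  have hmψ0 : 0 ≤ m * ψ := by positivity
  have hmψ : m ≤ ψ := by
    refine le_of_pow_le_pow_left₀ (n := 4) (by norm_num) hψ.le (le_trans ?_ h1)
    calc m ^ 4 ≤ m ^ 7 := pow_le_pow_right₀ hmpos (by norm_num)
      _ ≤ S ^ 7 := by gcongr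
  have hS7 : 0 ≤ S ^ 7 := by positivity
  have fin4 : (n * p) ^ 4 ≤ 2 ^ 46 * D * (m ^ 4 * S ^ 7) → n * p ≤ 2 ^ 46 * D * (m * ψ) := by
    intro h
    refine le_of_pow_le_mul (n := 4) (by norm_num) hK1 hmψ0 (h.trans ?_)
    rw [mul_pow]
    gcongr
  rcases hcases with h | h | h | h | h | h | h
  · calc n * p ≤ m * (2 * m) := by gcongr
      _ ≤ m * (2 * ψ) := by gcongr
      _ = 2 * (m * ψ) := by ring
      _ ≤ _ := by gcongr; linarith
  · apply fin4
    calc (n * p) ^ 4 = p ^ 2 * (p ^ 2 * n ^ 4) := by ring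
      _ ≤ (m ^ 2) ^ 2 * ((2 * m * x) ^ 2 * n ^ 4) := by gcongr
      _ = m ^ 4 * (4 * (m ^ 2 * (x ^ 2 * n ^ 4))) := by ring
      _ ≤ m ^ 4 * (4 * (m ^ 2 * U)) := by gcongr
      _ = 2 ^ 40 * D * (m ^ 4 * S ^ 7) := by rw [hQ4]; ring
      _ ≤ _ := by gcongr <;> norm_num
  · apply fin4
    calc (n * p) ^ 4 = (p ^ 2) ^ 2 * n ^ 4 := by ring
      _ ≤ (16 * m ^ 3 * z) ^ 2 * n ^ 4 := by gcongr
      _ = 256 * m ^ 4 * (m ^ 2 * (z ^ 2 * n ^ 4)) := by ring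
      _ ≤ 256 * m ^ 4 * (m ^ 2 * U) := by gcongr
      _ = 2 ^ 46 * D * (m ^ 4 * S ^ 7) := by rw [hQ4]; ring
  · apply fin4
    calc (n * p) ^ 4 = p * (p ^ 2 * (n * p) * n ^ 3) := by ring
      _ ≤ m ^ 2 * ((2 * m * x) ^ 2 * (n * p) * n ^ 3) := by gcongr
      _ = 4 * m ^ 4 * (x ^ 2 * (n * p) * n ^ 3) := by ring
      _ ≤ 4 * m ^ 4 * (8 * m ^ 2 * U) := by gcongr
      _ = 2 ^ 5 * m ^ 4 * (m ^ 2 * U) := by ring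
      _ = 2 ^ 43 * D * (m ^ 4 * S ^ 7) := by rw [hQ4]; ring
      _ ≤ _ := by gcongr <;> norm_num
  · refine le_of_pow_le_mul (n := 5) (by norm_num) hK1 hmψ0 ?_
    calc (n * p) ^ 5 = p ^ 3 * ((n * p) ^ 2 * n ^ 3) := by ring
      _ ≤ (m ^ 2) ^ 3 * (64 * m ^ 4 * V) := by gcongr
      _ = 64 * m ^ 8 * (m ^ 2 * V) := by ring
      _ = 2 ^ 44 * D * (m ^ 5 * (S ^ 6 * m ^ 3)) := by rw [hQ3]; ring
      _ ≤ 2 ^ 46 * D * (m ^ 5 * ψ ^ 5) := by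
        gcongr
        · norm_num
        · norm_num
        · exact le_trans (by gcongr) h2
      _ = _ := by ring
  · refine le_of_pow_le_mul (n := 4) (by norm_num) hK1 hmψ0 ?_
    have : q * (n * p) ^ 4 ≤ q * (2 ^ 46 * D * (m * ψ) ^ 4) := by
      calc q * (n * p) ^ 4 = p ^ 4 * (q * n ^ 4) := by ring
        _ ≤ (m ^ 2) ^ 4 * U := by gcongr
        _ = m ^ 6 * (m ^ 2 * U) := by ring
        _ = 2 ^ 38 * D * (m ^ 4 * (S ^ 7 * m ^ 2)) := by rw [hQ4]; ring
        _ ≤ 2 ^ 46 * D * (m ^ 4 * (q * ψ ^ 4)) := by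
          have e1 : S ^ 7 * m ^ 2 ≤ q * ψ ^ 4 := le_trans (by gcongr) h3
          refine mul_le_mul ?_ ?_ (by positivity) (by positivity)
          · linarith
          · exact mul_le_mul_of_nonneg_left e1 (by positivity)
        _ = _ := by ring
    exact le_of_mul_le_mul_left this hq
  · calc n * p ≤ m * (2 * m * (C * β)) := by gcongr; exact hpx.trans (by gcongr)
      _ = 2 * C * (m * (β * m)) := by ring
      _ ≤ 2 * C * (m * ψ) := by
        gcongr
        exact le_trans (by gcongr) h4
      _ ≤ _ := by
        refine mul_le_mul_of_nonneg_right ?_ hmψ0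
        rw [hD]
        nlinarith [sq_nonneg (C - 1)]

/-- number of representations of the ratio `ξ` -/
def nn (X Y : Finset F) (ξ : F) : ℕ := (X.filter fun x => ξ * x ∈ Y).card

lemma nn_self (A : Finset F) (ξ : F) : nn A A ξ = (Pr A ξ).card := rfl

lemma sum_nn_mul [Fintype F] {X Y Z W : Finset F} (hX : (0 : F) ∉ X) (hZ : (0 : F) ∉ Z) :
    ∑ ξ : F, nn X Y ξ * nn Z W ξ =
      (((X ×ˢ Z) ×ˢ (Y ×ˢ W)).filter fun t => t.2.1 * t.1.2 = t.2.2 * t.1.1).card := by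
  have : ∀ ξ : F, nn X Y ξ * nn Z W ξ =
      ((X.filter fun x => ξ * x ∈ Y) ×ˢ (Z.filter fun x => ξ * x ∈ W)).card := by
    intro ξ; rw [Finset.card_product]; rfl
  simp only [this]
  rw [← Finset.card_sigma]
  refine Finset.card_bij (fun s _ => ((s.2.1, s.2.2), (s.1 * s.2.1, s.1 * s.2.2))) ?_ ?_ ?_
  · rintro ⟨ξ, x, z⟩ h
    simp only [Finset.mem_sigma, Finset.mem_univ, true_and, Finset.mem_product,
      Finset.mem_filter] at h ⊢
    refine ⟨⟨⟨h.1.1, h.2.1⟩, h.1.2, h.2.2⟩, by ring⟩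
  · rintro ⟨ξ, x, z⟩ h ⟨ξ', x', z'⟩ h' heq
    simp only [Finset.mem_sigma, Finset.mem_univ, true_and, Finset.mem_product,
      Finset.mem_filter] at h h'
    simp only [Prod.mk.injEq] at heq
    obtain ⟨⟨rfl, rfl⟩, h1, -⟩ := heq
    have hx : x ≠ 0 := fun e => hX (e ▸ h.1.1)
    have := mul_right_cancel₀ hx h1
    subst this; rfl
  · rintro ⟨⟨x, z⟩, y, w⟩ h
    simp only [Finset.mem_product, Finset.mem_filter] at h
    obtain ⟨⟨⟨h1, h2⟩, h3, h4⟩, h5⟩ := h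
    have hx : x ≠ 0 := fun e => hX (e ▸ h1)
    have e1 : y / x * x = y := by field_simp
    have e2 : y / x * z = w := by field_simp; rw [h5, mul_comm]
    refine ⟨⟨y / x, x, z⟩, ?_, ?_⟩
    · simp only [Finset.mem_sigma, Finset.mem_univ, true_and, Finset.mem_product,
        Finset.mem_filter, e1, e2]
      exact ⟨⟨h1, h3⟩, h2, h4⟩
    · simp only [e1, e2]

/-- multiplicative (ratio) energy -/
def EE [Fintype F] (A : Finset F) : ℝ := ∑ ξ : F, (nn A A ξ : ℝ) ^ 2

lemma cross_sum [Fintype F] {X Y : Finset F} (hX : (0 : F) ∉ X) (hY : (0 : F) ∉ Y) :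
    ∑ ξ : F, (nn X X ξ : ℝ) * nn Y Y ξ ≤ (EE X + EE Y) / 2 := by
  unfold EE
  rw [← Finset.sum_add_distrib, Finset.sum_div]
  refine Finset.sum_le_sum fun ξ _ => ?_
  nlinarith [sq_nonneg ((nn X X ξ : ℝ) - nn Y Y ξ)]

lemma mixed_sum [Fintype F] {X Y : Finset F} (hX : (0 : F) ∉ X) (hY : (0 : F) ∉ Y) :
    ∑ ξ : F, (nn X Y ξ : ℝ) ^ 2 ≤ (EE X + EE Y) / 2 := by
  refine le_trans (le_of_eq ?_) (cross_sum hX hY)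
  have h1 := sum_nn_mul (X := X) (Y := Y) (Z := X) (W := Y) hX hX
  have h2 := sum_nn_mul (X := X) (Y := X) (Z := Y) (W := Y) hX hY
  have h3 : ∑ ξ : F, nn X Y ξ * nn X Y ξ = ∑ ξ : F, nn X X ξ * nn Y Y ξ := by
    rw [h1, h2]
    refine Finset.card_bij (fun t _ => ((t.1.1, t.2.1), (t.1.2, t.2.2))) ?_ ?_ ?_
    · rintro ⟨⟨a, b⟩, c, d⟩ h
      simp only [Finset.mem_product, Finset.mem_filter] at h ⊢
      refine ⟨⟨⟨h.1.1.1, h.1.2.1⟩, h.1.1.2, h.1.2.2⟩, by rw [mul_comm]; exact h.2⟩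
    · rintro ⟨⟨a, b⟩, c, d⟩ h ⟨⟨a', b'⟩, c', d'⟩ h' heq
      simp only [Prod.mk.injEq] at heq ⊢
      tauto
    · rintro ⟨⟨a, b⟩, c, d⟩ h
      simp only [Finset.mem_product, Finset.mem_filter] at h
      refine ⟨((a, c), (b, d)), ?_, rfl⟩
      simp only [Finset.mem_product, Finset.mem_filter]
      refine ⟨⟨⟨h.1.1.1, h.1.2.1⟩, h.1.1.2, h.1.2.2⟩, by rw [mul_comm]; exact h.2⟩
  simp only [sq]
  exact_mod_cast h3

lemma nn_split {A B : Finset F} (hB : B ⊆ A) (ξ : F) :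
    nn A A ξ ≤ nn B B ξ + nn B (A \ B) ξ + nn (A \ B) B ξ + nn (A \ B) (A \ B) ξ := by
  unfold nn
  have : (A.filter fun x => ξ * x ∈ A) ⊆ (B.filter fun x => ξ * x ∈ B) ∪
      (B.filter fun x => ξ * x ∈ A \ B) ∪ ((A \ B).filter fun x => ξ * x ∈ B) ∪
      ((A \ B).filter fun x => ξ * x ∈ A \ B) := by
    intro x hx
    simp only [Finset.mem_filter, Finset.mem_union, Finset.mem_sdiff] at hx ⊢
    tauto
  refine (Finset.card_le_card this).trans ((Finset.card_union_le _ _).trans ?_)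
  gcongr
  refine (Finset.card_union_le _ _).trans ?_
  gcongr
  exact Finset.card_union_le _ _

lemma EE_split [Fintype F] {A B : Finset F} (h0 : (0 : F) ∉ A) (hB : B ⊆ A) :
    EE A ≤ 8 * (EE B + EE (A \ B)) := by
  have hX : (0 : F) ∉ B := fun h => h0 (hB h)
  have hY : (0 : F) ∉ A \ B := fun h => h0 (Finset.sdiff_subset h)
  have h1 := mixed_sum hX hY
  have h2 := mixed_sum hY hX
  have : EE A ≤ ∑ ξ : F, 4 * ((nn B B ξ : ℝ) ^ 2 + (nn B (A \ B) ξ : ℝ) ^ 2 +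
      (nn (A \ B) B ξ : ℝ) ^ 2 + (nn (A \ B) (A \ B) ξ : ℝ) ^ 2) := by
    unfold EE
    refine Finset.sum_le_sum fun ξ _ => ?_
    have h := nn_split hB ξ
    have h' : (nn A A ξ : ℝ) ≤ nn B B ξ + nn B (A \ B) ξ + nn (A \ B) B ξ +
      nn (A \ B) (A \ B) ξ := by exact_mod_cast h
    refine (pow_le_pow_left₀ (Nat.cast_nonneg _) h' 2).trans ?_
    generalize (nn B B ξ : ℝ) = a
    generalize (nn B (A \ B) ξ : ℝ) = b
    generalize (nn (A \ B) B ξ : ℝ) = c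
    generalize (nn (A \ B) (A \ B) ξ : ℝ) = d
    nlinarith [sq_nonneg (a - b), sq_nonneg (a - c), sq_nonneg (a - d), sq_nonneg (b - c),
      sq_nonneg (b - d), sq_nonneg (c - d)]
  refine this.trans ?_
  rw [← Finset.mul_sum, Finset.sum_add_distrib, Finset.sum_add_distrib, Finset.sum_add_distrib]
  have e1 : ∑ ξ : F, (nn B B ξ : ℝ) ^ 2 = EE B := rfl
  have e2 : ∑ ξ : F, (nn (A \ B) (A \ B) ξ : ℝ) ^ 2 = EE (A \ B) := rfl
  rw [e1, e2]
  linarith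

lemma sum_lev [Fintype F] {A : Finset F} (h0 : (0 : F) ∉ A) (N : ℕ) :
    ∑ ξ ∈ Finset.univ.filter (fun ξ : F => lev A N ξ), nn A A ξ ≤ (PP A N).card := by
  unfold nn
  rw [← Finset.card_sigma]
  refine Finset.card_le_card_of_injOn (fun s => (s.2, s.1 * s.2)) ?_ ?_
  · rintro ⟨ξ, x⟩ h
    simp only [Finset.mem_coe, Finset.mem_sigma, Finset.mem_filter, Finset.mem_univ, true_and,
      PP, Finset.mem_product] at h ⊢
    have hx0 : x ≠ 0 := fun e => h0 (e ▸ h.2.1)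
    refine ⟨h.2, ?_⟩
    rw [mul_div_cancel_right₀ _ hx0]; exact h.1
  · rintro ⟨ξ, x⟩ h ⟨ξ', x'⟩ h' heq
    simp only [Finset.mem_coe, Finset.mem_sigma, Finset.mem_filter, Finset.mem_univ, true_and]
      at h h'
    simp only [Prod.mk.injEq] at heq
    obtain ⟨rfl, h2⟩ := heq
    have hx0 : x ≠ 0 := fun e => h0 (e ▸ h.2.1)
    have := mul_right_cancel₀ hx0 h2
    subst this; rfl

lemma EE_dyadic [Fintype F] {A : Finset F} (h0 : (0 : F) ∉ A) {M : ℕ} (hM : A.card ≤ M) {K : ℝ}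
    (hK : ∀ N : ℕ, 0 < N → (N : ℝ) * (PP A N).card ≤ K) :
    EE A ≤ (Nat.log 2 M + 1 : ℕ) * (2 * K) := by
  have h1 : ∀ ξ : F, (nn A A ξ : ℝ) ^ 2 ≤ ∑ j ∈ Finset.range (Nat.log 2 M + 1),
      if lev A (2 ^ j) ξ then 2 * (2 : ℝ) ^ j * nn A A ξ else 0 := by
    intro ξ
    have hnon : ∀ j ∈ Finset.range (Nat.log 2 M + 1),
        (0 : ℝ) ≤ if lev A (2 ^ j) ξ then 2 * (2 : ℝ) ^ j * nn A A ξ else 0 := by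
      intro j _
      split_ifs <;> positivity
    rcases Nat.eq_zero_or_pos (nn A A ξ) with hz | hp
    · rw [hz]
      refine le_trans (by simp) (Finset.sum_nonneg ?_)
      intro j _
      split_ifs <;> simp
    · have hle : nn A A ξ ≤ M := (Finset.card_filter_le _ _).trans hM
      have hl1 := Nat.pow_log_le_self 2 hp.ne'
      have hl2 := Nat.lt_pow_succ_log_self (b := 2) (by norm_num) (nn A A ξ)
      have hj : Nat.log 2 (nn A A ξ) ∈ Finset.range (Nat.log 2 M + 1) :=
        Finset.mem_range.2 (Nat.lt_succ_of_le (Nat.log_mono_right hle))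
      refine le_trans ?_ (Finset.single_le_sum hnon hj)
      have hlev : lev A (2 ^ Nat.log 2 (nn A A ξ)) ξ := by
        refine ⟨hl1, ?_⟩
        rw [pow_succ, mul_comm] at hl2
        exact hl2
      rw [if_pos hlev, sq]
      gcongr
      rw [pow_succ, mul_comm] at hl2
      exact_mod_cast hl2.le
  calc EE A ≤ ∑ ξ : F, ∑ j ∈ Finset.range (Nat.log 2 M + 1),
      (if lev A (2 ^ j) ξ then 2 * (2 : ℝ) ^ j * nn A A ξ else 0) :=
        Finset.sum_le_sum fun ξ _ => h1 ξ
    _ = ∑ j ∈ Finset.range (Nat.log 2 M + 1), ∑ ξ : F,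
      (if lev A (2 ^ j) ξ then 2 * (2 : ℝ) ^ j * nn A A ξ else 0) := Finset.sum_comm
    _ ≤ ∑ j ∈ Finset.range (Nat.log 2 M + 1), 2 * K := by
        refine Finset.sum_le_sum fun j _ => ?_
        rw [← Finset.sum_filter, ← Finset.mul_sum]
        have h2 := sum_lev h0 (2 ^ j)
        have h3 : (∑ ξ ∈ Finset.univ.filter (fun ξ : F => lev A (2 ^ j) ξ), (nn A A ξ : ℝ)) ≤
          (PP A (2 ^ j)).card := by exact_mod_cast h2
        have h4 := hK (2 ^ j) (by positivity)
        push_cast at h4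
        calc _ ≤ 2 * (2 : ℝ) ^ j * (PP A (2 ^ j)).card := by gcongr
          _ ≤ 2 * K := by linarith
    _ = _ := by rw [Finset.sum_const, Finset.card_range, nsmul_eq_mul]

lemma subfieldCond_mono {A X : Finset F} {C β : ℝ} (h : subfieldCond A C β) (hX : X ⊆ A) :
    subfieldCond X C β := by
  intro G hG c d
  refine subfieldCond_mem h G hG c d ((Finset.filter_subset _ _).trans hX) ?_
  intro x hx
  exact (Finset.mem_filter.1 hx).2

lemma good_subset {A : Finset F} {e : F} {S : ℝ} (hne : A.Nonempty)
    (hAe : ((A + A.image (e * ·)).card : ℝ) ≤ S) (hS : 0 ≤ S) :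
    ∃ B ⊆ A, ((A \ B).card : ℝ) ≤ A.card / 16 ∧ B.Nonempty ∧
      ((q4 B e).card : ℝ) ≤ 4096 * S ^ 3 / (B.card : ℝ) ^ 2 := by
  have hA : (0 : ℝ) < A.card := by exact_mod_cast hne.card_pos
  set D := A.image (e * ·) with hD
  obtain ⟨B, hBA, h1, h2⟩ := union_pieces (D + D + D) ((A.card : ℝ) / 16)
    ((16 * S / A.card) ^ 3) (by positivity) (by positivity) A.card A le_rfl (by
      intro X1 hX1 hc
      have hX1p : (0 : ℝ) < X1.card := lt_trans (by positivity) hc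
      have hX1ne : X1.Nonempty := Finset.card_pos.1 (by exact_mod_cast hX1p)
      obtain ⟨X', hs, hn, -, h⟩ := petridis_two X1 D hX1ne
      refine ⟨X', hs, hn, ?_⟩
      have e1 : X' + (D + D + D) = X' + D + D + D := by simp only [add_assoc]
      rw [e1]
      have e2 : ((X1 + D).card : ℝ) ≤ S :=
        le_trans (by exact_mod_cast Finset.card_le_card (Finset.add_subset_add_right hX1)) hAe
      have e3 : ((X' + D + D + D).card : ℝ) * X1.card ^ 3 ≤ S ^ 3 * X'.card :=
        h.trans (by gcongr)
      have e4 : ((X' + D + D + D).card : ℝ) ≤ S ^ 3 * X'.card / X1.card ^ 3 := by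
        rw [le_div_iff₀ (by positivity)]; exact e3
      refine e4.trans ?_
      have e5 : S ^ 3 * X'.card / (X1.card : ℝ) ^ 3 ≤
          S ^ 3 * X'.card / ((A.card : ℝ) / 16) ^ 3 := by gcongr
      refine e5.trans (le_of_eq ?_)
      field_simp)
  have hcard : ((A \ B).card : ℝ) = A.card - B.card := by
    rw [Finset.card_sdiff_of_subset hBA, Nat.cast_sub (Finset.card_le_card hBA)]
  have hBp : (0 : ℝ) < B.card := by linarith
  have hBne : B.Nonempty := Finset.card_pos.1 (by exact_mod_cast hBp)
  refine ⟨B, hBA, h1, hBne, ?_⟩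
  have hsub : q4 B e ⊆ B + (D + D + D) := by
    unfold q4
    refine Finset.add_subset_add_left ?_
    intro v hv
    obtain ⟨w, hw, rfl⟩ := Finset.mem_image.1 hv
    obtain ⟨u, hu, c, hc, rfl⟩ := Finset.mem_add.1 hw
    obtain ⟨a, ha, b, hb, rfl⟩ := Finset.mem_add.1 hu
    have : e * (a + b + c) = e * a + e * b + e * c := by ring
    simp only [this]
    exact Finset.add_mem_add (Finset.add_mem_add (Finset.mem_image_of_mem _ (hBA ha))
      (Finset.mem_image_of_mem _ (hBA hb))) (Finset.mem_image_of_mem _ (hBA hc))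
  have hBAc : (B.card : ℝ) ≤ A.card := by exact_mod_cast Finset.card_le_card hBA
  calc ((q4 B e).card : ℝ) ≤ (B + (D + D + D)).card := by
        exact_mod_cast Finset.card_le_card hsub
    _ ≤ (16 * S / A.card) ^ 3 * B.card := h2
    _ = 4096 * S ^ 3 * (B.card / (A.card : ℝ) ^ 3) := by rw [div_pow, mul_pow]; ring
    _ ≤ 4096 * S ^ 3 * (B.card / (B.card : ℝ) ^ 3) := by gcongr
    _ = _ := by field_simp

lemma energy_bound [Fintype F] {e : F} (he : e = 1 ∨ e = -1) {S C β ψ : ℝ} {M : ℕ}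
    (hC : 0 < C) (hβ : 0 ≤ β) (hψ : 0 < ψ) (hMS : (M : ℝ) ≤ S)
    (h1 : S ^ 7 ≤ ψ ^ 4) (h2 : S ^ 6 * (M : ℝ) ^ 3 ≤ ψ ^ 5)
    (h3 : S ^ 7 * (M : ℝ) ^ 2 ≤ Fintype.card F * ψ ^ 4) (h4 : β * M ≤ ψ) :
    ∀ n : ℕ, ∀ A : Finset F, A.card ≤ n → (0 : F) ∉ A → A.card ≤ M →
      ((A + A.image (e * ·)).card : ℝ) ≤ S → subfieldCond A C β →
      EE A ≤ 16 * ((Nat.log 2 M + 1 : ℕ) * (2 * (2 ^ 46 * (1 + C ^ 2)))) * (A.card * ψ) := by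
  intro n
  have hS : 0 ≤ S := le_trans (Nat.cast_nonneg _) hMS
  set L : ℝ := ((Nat.log 2 M + 1 : ℕ) : ℝ) with hL
  have hL0 : 0 ≤ L := Nat.cast_nonneg _
  have empt : EE (∅ : Finset F) = 0 := by
    unfold EE nn; simp
  induction n with
  | zero =>
    intro A hA _ _ _ _
    have : A = ∅ := Finset.card_eq_zero.1 (Nat.le_zero.1 hA)
    subst this
    rw [empt]; simp
  | succ n ih =>
    intro A hA h0 hAM hAe hsub
    rcases A.eq_empty_or_nonempty with rfl | hne
    · rw [empt]; simp
    obtain ⟨B, hBA, hd, hBne, hQ⟩ := good_subset hne hAe hS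
    have hB0 : (0 : F) ∉ B := fun h => h0 (hBA h)
    have hBM : B.card ≤ M := (Finset.card_le_card hBA).trans hAM
    have hBMr : (B.card : ℝ) ≤ M := by exact_mod_cast hBM
    have hmono : ∀ X ⊆ A, ((X + X.image (e * ·)).card : ℝ) ≤ S := by
      intro X hX
      refine le_trans ?_ hAe
      exact_mod_cast Finset.card_le_card (Finset.add_subset_add hX (Finset.image_subset_image hX))
    have hEB : EE B ≤ L * (2 * (2 ^ 46 * (1 + C ^ 2) * (B.card * ψ))) :=
      EE_dyadic hB0 hBM fun N hN => core_bound hB0 he (hmono B hBA) (hBMr.trans hMS) hQ hN hC hβ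
        (subfieldCond_mono hsub hBA) hBMr hψ h1 h2 h3 h4
    have hlt : (A \ B).card < A.card := by
      refine Finset.card_lt_card ⟨Finset.sdiff_subset, fun h => ?_⟩
      obtain ⟨b, hb⟩ := hBne
      exact (Finset.mem_sdiff.1 (h (hBA hb))).2 hb
    have hEd := ih (A \ B) (by omega) (fun h => h0 (Finset.sdiff_subset h)) (by omega)
      (hmono _ Finset.sdiff_subset) (subfieldCond_mono hsub Finset.sdiff_subset)
    have hsp := EE_split h0 hBA
    have hBAc : (B.card : ℝ) ≤ A.card := by exact_mod_cast Finset.card_le_card hBA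
    set K : ℝ := 2 * (2 ^ 46 * (1 + C ^ 2)) with hK
    have hK0 : 0 ≤ K := by positivity
    have t1 : EE B ≤ L * K * (A.card * ψ) := by
      calc EE B ≤ L * K * (B.card * ψ) := by rw [hK]; linarith
        _ ≤ _ := by gcongr
    have t2 : EE (A \ B) ≤ L * K * (A.card * ψ) := by
      calc EE (A \ B) ≤ 16 * (L * K) * ((A \ B).card * ψ) := hEd
        _ ≤ 16 * (L * K) * (A.card / 16 * ψ) := by gcongr
        _ = _ := by ring
    linarith

/-- translate of `A` by `-a` with zero removed -/
def sh (A : Finset F) (a : F) : Finset F := (A.image (· - a)).erase 0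

lemma sh_card (A : Finset F) (a : F) : (sh A a).card ≤ A.card :=
  (Finset.card_le_card (Finset.erase_subset _ _)).trans Finset.card_image_le

lemma sh_zero (A : Finset F) (a : F) : (0 : F) ∉ sh A a := Finset.notMem_erase _ _

lemma mem_sh {A : Finset F} {a x : F} (hx : x ∈ A) (h : x - a ≠ 0) : x - a ∈ sh A a :=
  Finset.mem_erase.2 ⟨h, Finset.mem_image_of_mem _ hx⟩

lemma sh_sum (A : Finset F) (a e : F) :
    (sh A a + (sh A a).image (e * ·)).card ≤ (A + A.image (e * ·)).card := by
  have : sh A a + (sh A a).image (e * ·) ⊆ (A + A.image (e * ·)).image (· - (a + e * a)) := by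
    intro v hv
    obtain ⟨x, hx, y, hy, rfl⟩ := Finset.mem_add.1 hv
    obtain ⟨z, hz, rfl⟩ := Finset.mem_image.1 hy
    obtain ⟨x', hx', rfl⟩ := Finset.mem_image.1 (Finset.mem_of_mem_erase hx)
    obtain ⟨z', hz', rfl⟩ := Finset.mem_image.1 (Finset.mem_of_mem_erase hz)
    refine Finset.mem_image.2 ⟨x' + e * z',
      Finset.add_mem_add hx' (Finset.mem_image_of_mem _ hz'), ?_⟩
    ring
  exact (Finset.card_le_card this).trans Finset.card_image_le

lemma sh_sub {A : Finset F} {C β : ℝ} (h : subfieldCond A C β) (a : F) :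
    subfieldCond (sh A a) C β := by
  refine subfieldCond_mono (A := A.image (· - a)) ?_ (Finset.erase_subset _ _)
  intro G hG c d
  have key := subfieldCond_mem (X := ((A.image (· - a)).filter
    fun x => ∃ g ∈ G, x = c * g + d).image (· + a)) h G hG c (d + a) (by
      intro v hv
      obtain ⟨x, hx, rfl⟩ := Finset.mem_image.1 hv
      obtain ⟨y, hy, rfl⟩ := Finset.mem_image.1 (Finset.mem_filter.1 hx).1
      simpa using hy) (by
      intro v hv
      obtain ⟨x, hx, rfl⟩ := Finset.mem_image.1 hv
      obtain ⟨g, hg, hgx⟩ := (Finset.mem_filter.1 hx).2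
      exact ⟨g, hg, by simp only [hgx]; ring⟩)
  rw [Finset.card_image_of_injective _ (add_left_injective a)] at key
  exact key

lemma fiber_bound [Fintype F] (A : Finset F) {a b : F} :
    (((A ×ˢ A) ×ˢ (A ×ˢ A)).filter fun t : (F × F) × (F × F) =>
      (t.1.1 - a) * (t.2.2 - b) = (t.1.2 - a) * (t.2.1 - b)).card ≤
      4 * A.card ^ 2 + ∑ ξ : F, nn (sh A a) (sh A a) ξ * nn (sh A b) (sh A b) ξ := by
  rw [sum_nn_mul (sh_zero A a) (sh_zero A b)]
  set Q := ((A ×ˢ A) ×ˢ (A ×ˢ A)).filter fun t : (F × F) × (F × F) =>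
      (t.1.1 - a) * (t.2.2 - b) = (t.1.2 - a) * (t.2.1 - b) with hQ
  set N := Q.filter fun t => t.1.1 - a ≠ 0 ∧ t.1.2 - a ≠ 0 ∧ t.2.1 - b ≠ 0 ∧ t.2.2 - b ≠ 0
    with hN
  have hsub : Q ⊆ (({a} ×ˢ {a}) ×ˢ (A ×ˢ A)) ∪ ((A ×ˢ A) ×ˢ ({b} ×ˢ {b})) ∪
      (({a} ×ˢ A) ×ˢ ({b} ×ˢ A)) ∪ ((A ×ˢ {a}) ×ˢ (A ×ˢ {b})) ∪ N := by
    rintro ⟨⟨x, y⟩, z, w⟩ ht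
    by_cases hn : ((x, y), z, w) ∈ N
    · exact Finset.mem_union_right _ hn
    have hn' : ¬ (x - a ≠ 0 ∧ y - a ≠ 0 ∧ z - b ≠ 0 ∧ w - b ≠ 0) := fun h =>
      hn (Finset.mem_filter.2 ⟨ht, h⟩)
    obtain ⟨hm, heq⟩ := Finset.mem_filter.1 ht
    simp only [Finset.mem_product] at hm heq
    obtain ⟨⟨hx, hy⟩, hz, hw⟩ := hm
    have hzero : (x - a) * (w - b) = 0 ∧ (y - a) * (z - b) = 0 := by
      by_contra hc
      have h1 : (x - a) * (w - b) ≠ 0 := by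
        intro h
        exact hc ⟨h, by rw [← heq, h]⟩
      have h2 : (y - a) * (z - b) ≠ 0 := by rw [← heq]; exact h1
      exact hn' ⟨left_ne_zero_of_mul h1, left_ne_zero_of_mul h2, right_ne_zero_of_mul h2,
        right_ne_zero_of_mul h1⟩
    simp only [mul_eq_zero, sub_eq_zero] at hzero
    simp only [Finset.mem_union, Finset.mem_product, Finset.mem_singleton]
    left
    obtain ⟨h | h, h' | h'⟩ := hzero
    · exact Or.inl (Or.inl (Or.inl ⟨⟨h, h'⟩, hz, hw⟩))
    · exact Or.inl (Or.inr ⟨⟨h, hy⟩, h', hw⟩)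
    · exact Or.inr ⟨⟨hx, h'⟩, hz, h⟩
    · exact Or.inl (Or.inl (Or.inr ⟨⟨hx, hy⟩, h', h⟩))
  have hNc : N.card ≤ (((sh A a ×ˢ sh A b) ×ˢ (sh A a ×ˢ sh A b)).filter
      fun t => t.2.1 * t.1.2 = t.2.2 * t.1.1).card := by
    refine Finset.card_le_card_of_injOn
      (fun t => ((t.1.1 - a, t.2.1 - b), (t.1.2 - a, t.2.2 - b))) ?_ ?_
    · rintro ⟨⟨x, y⟩, z, w⟩ ht
      obtain ⟨ht, h1, h2, h3, h4⟩ := Finset.mem_filter.1 (Finset.mem_coe.1 ht)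
      obtain ⟨hm, heq⟩ := Finset.mem_filter.1 ht
      simp only [Finset.mem_product] at hm heq
      obtain ⟨⟨hx, hy⟩, hz, hw⟩ := hm
      refine Finset.mem_coe.2 (Finset.mem_filter.2 ⟨?_, ?_⟩)
      · simp only [Finset.mem_product]
        exact ⟨⟨mem_sh hx h1, mem_sh hz h3⟩, mem_sh hy h2, mem_sh hw h4⟩
      · simp only
        rw [← heq, mul_comm]
    · rintro ⟨⟨x, y⟩, z, w⟩ _ ⟨⟨x', y'⟩, z', w'⟩ _ h
      simp only [Prod.mk.injEq, sub_left_inj] at h ⊢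
      tauto
  have hc := Finset.card_le_card hsub
  have u1 := Finset.card_union_le ((({a} ×ˢ {a}) ×ˢ (A ×ˢ A)) ∪ ((A ×ˢ A) ×ˢ ({b} ×ˢ {b})) ∪
      (({a} ×ˢ A) ×ˢ ({b} ×ˢ A)) ∪ ((A ×ˢ {a}) ×ˢ (A ×ˢ {b}))) N
  have u2 := Finset.card_union_le ((({a} ×ˢ {a}) ×ˢ (A ×ˢ A)) ∪ ((A ×ˢ A) ×ˢ ({b} ×ˢ {b})) ∪
      (({a} ×ˢ A) ×ˢ ({b} ×ˢ A))) ((A ×ˢ {a}) ×ˢ (A ×ˢ {b}))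
  have u3 := Finset.card_union_le ((({a} ×ˢ {a}) ×ˢ (A ×ˢ A)) ∪ ((A ×ˢ A) ×ˢ ({b} ×ˢ {b})))
      (({a} ×ˢ A) ×ˢ ({b} ×ˢ A))
  have u4 := Finset.card_union_le (({a} ×ˢ {a}) ×ˢ (A ×ˢ A)) ((A ×ˢ A) ×ˢ ({b} ×ˢ {b}))
  simp only [Finset.card_product, Finset.card_singleton, one_mul, mul_one] at u1 u2 u3 u4
  simp only [sq]
  omega

lemma T_bound [Fintype F] (A : Finset F) {E : ℝ} (hE : ∀ a ∈ A, EE (sh A a) ≤ E) :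
    (collinearTriples A A : ℝ) ≤ (A.card : ℝ) ^ 2 * (4 * (A.card : ℝ) ^ 2 + E) := by
  unfold collinearTriples
  set T := (((A ×ˢ A ×ˢ A) ×ˢ (A ×ˢ A ×ˢ A)).filter fun x =>
    (x.1.2.1 - x.1.1) * (x.2.2.2 - x.2.1) = (x.1.2.2 - x.1.1) * (x.2.2.1 - x.2.1)) with hT
  have hmap : ∀ x ∈ T, (x.1.1, x.2.1) ∈ A ×ˢ A := by
    intro x hx
    have := (Finset.mem_filter.1 hx).1
    simp only [Finset.mem_product] at this ⊢
    exact ⟨this.1.1, this.2.1⟩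
  rw [Finset.card_eq_sum_card_fiberwise (s := T)
    (f := fun x : (F × F × F) × (F × F × F) => (x.1.1, x.2.1)) (t := A ×ˢ A)
    (fun x hx => hmap x hx)]
  push_cast
  have : ∀ p ∈ A ×ˢ A, ((T.filter fun x => (x.1.1, x.2.1) = p).card : ℝ) ≤
      4 * (A.card : ℝ) ^ 2 + E := by
    rintro ⟨a, b⟩ hp
    obtain ⟨ha, hb⟩ := Finset.mem_product.1 hp
    have h1 : (T.filter fun x => (x.1.1, x.2.1) = (a, b)).card ≤
      (((A ×ˢ A) ×ˢ (A ×ˢ A)).filter fun t : (F × F) × (F × F) =>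
      (t.1.1 - a) * (t.2.2 - b) = (t.1.2 - a) * (t.2.1 - b)).card := by
      refine Finset.card_le_card_of_injOn (fun x => (x.1.2, x.2.2)) ?_ ?_
      · rintro ⟨⟨a', x, y⟩, b', z, w⟩ h
        obtain ⟨h5, he⟩ := Finset.mem_filter.1 (Finset.mem_coe.1 h)
        simp only [Prod.mk.injEq] at he
        obtain ⟨rfl, rfl⟩ := he
        obtain ⟨h6, heq⟩ := Finset.mem_filter.1 h5
        simp only [Finset.mem_product] at h6
        refine Finset.mem_coe.2 (Finset.mem_filter.2 ⟨?_, heq⟩)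
        simp only [Finset.mem_product]
        tauto
      · rintro ⟨⟨a', x, y⟩, b', z, w⟩ h ⟨⟨a'', x', y'⟩, b'', z', w'⟩ h' hh
        have he := (Finset.mem_filter.1 (Finset.mem_coe.1 h)).2
        have he' := (Finset.mem_filter.1 (Finset.mem_coe.1 h')).2
        simp only [Prod.mk.injEq] at he he' hh ⊢
        obtain ⟨rfl, rfl⟩ := he
        obtain ⟨rfl, rfl⟩ := he'
        tauto
    have h2 := h1.trans (fiber_bound A)
    have h3 := cross_sum (sh_zero A a) (sh_zero A b)
    have h4 : ((T.filter fun x => (x.1.1, x.2.1) = (a, b)).card : ℝ) ≤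
      4 * (A.card : ℝ) ^ 2 + ∑ ξ : F, (nn (sh A a) (sh A a) ξ : ℝ) * nn (sh A b) (sh A b) ξ := by
      exact_mod_cast h2
    have h5 := hE a ha
    have h6 := hE b hb
    linarith
  refine (Finset.sum_le_sum this).trans (le_of_eq ?_)
  rw [Finset.sum_const, Finset.card_product, nsmul_eq_mul]
  push_cast; ring

lemma final_e [Fintype F] {C δ : ℝ} (hC : 0 < C) (hδ : 0 < δ) {e : F} (he : e = 1 ∨ e = -1)
    {A : Finset F} (hA : 2 ≤ A.card) (hsub : subfieldCond A C ((A.card : ℝ) ^ ((1:ℝ) - δ)))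
    {n q : ℕ} (hn : (A + A.image (e * ·)).card = n) (hq : Fintype.card F = q) :
    (collinearTriples A A : ℝ) ≤
      (6 + 48 * (2 * (2 ^ 46 * (1 + C ^ 2)))) * Real.log (A.card : ℝ) *
        max (max ((n : ℝ) ^ ((7:ℝ)/4) * (A.card : ℝ) ^ (3:ℕ))
            ((n : ℝ) ^ ((6:ℝ)/5) * (A.card : ℝ) ^ ((18:ℝ)/5)))
          (max ((A.card : ℝ) ^ ((5:ℝ) - δ/2))
            ((n : ℝ) ^ ((7:ℝ)/4) * (A.card : ℝ) ^ ((7:ℝ)/2) * (q : ℝ) ^ (-(1:ℝ)/4))) := by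
  have hmn : A.card ≤ n := by
    rw [← hn]
    refine Finset.card_le_card_add_right ?_
    have : A.Nonempty := Finset.card_pos.1 (by omega)
    exact this.image _
  have hSe : ((A + A.image (e * ·)).card : ℝ) ≤ n := by rw [hn]
  have hqp : (0 : ℝ) < q := by rw [← hq]; exact_mod_cast Fintype.card_pos
  have hlog : ((Nat.log 2 A.card + 1 : ℕ) : ℝ) ≤ 3 * Real.log A.card ∧
      (4 : ℝ) ≤ 6 * Real.log A.card := by
    have l2 := Real.log_two_gt_d9
    have hA' : (2 : ℝ) ≤ A.card := by exact_mod_cast hA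
    have hl1 : Real.log 2 ≤ Real.log A.card := Real.log_le_log (by norm_num) hA'
    have hp : (2 : ℝ) ^ Nat.log 2 A.card ≤ A.card := by
      exact_mod_cast Nat.pow_log_le_self 2 (by omega)
    have hl2 := Real.log_le_log (by positivity) hp
    rw [Real.log_pow] at hl2
    have hk : (0 : ℝ) ≤ (Nat.log 2 A.card : ℝ) := Nat.cast_nonneg _
    constructor
    · push_cast
      nlinarith
    · linarith
  set K : ℝ := 2 * (2 ^ 46 * (1 + C ^ 2)) with hK
  have hK0 : 0 ≤ K := by positivity
  obtain ⟨hL, h4⟩ := hlog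
  have hmS : (A.card : ℝ) ≤ n := by exact_mod_cast hmn
  have hm2 : (2 : ℝ) ≤ A.card := by exact_mod_cast hA
  have hm : (0 : ℝ) < A.card := by linarith
  have hm1 : (1 : ℝ) ≤ A.card := by linarith
  have hS1 : (1 : ℝ) ≤ n := by linarith
  have hS : (0 : ℝ) < n := by linarith
  have pw : ∀ (x : ℝ) (y : ℝ) (k j : ℕ), 0 < x → y * k = j → (x ^ y) ^ k = x ^ j := by
    intro x y k j hx h
    rw [← Real.rpow_natCast, ← Real.rpow_mul hx.le, h, Real.rpow_natCast]
  have hu := pw n ((7:ℝ)/4) 4 7 hS (by norm_num)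
  have hv := pw n ((6:ℝ)/5) 5 6 hS (by norm_num)
  have hw := pw A.card ((3:ℝ)/5) 5 3 hm (by norm_num)
  have hr := pw A.card ((1:ℝ)/2) 2 1 hm (by norm_num)
  have ht : (q : ℝ) * ((q : ℝ) ^ (-(1:ℝ)/4)) ^ 4 = 1 := by
    rw [← Real.rpow_natCast, ← Real.rpow_mul hqp.le]
    norm_num
    rw [Real.rpow_neg_one, mul_inv_cancel₀ hqp.ne']
  have m1 : (A.card : ℝ) ^ ((18:ℝ)/5) = (A.card : ℝ) ^ 3 * (A.card : ℝ) ^ ((3:ℝ)/5) := by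
    rw [← Real.rpow_natCast, ← Real.rpow_add hm]; norm_num
  have m2 : (A.card : ℝ) ^ ((7:ℝ)/2) = (A.card : ℝ) ^ 3 * (A.card : ℝ) ^ ((1:ℝ)/2) := by
    rw [← Real.rpow_natCast, ← Real.rpow_add hm]; norm_num
  have m3 : (A.card : ℝ) ^ 3 * ((A.card : ℝ) ^ ((1:ℝ) - δ) * A.card) ≤
      (A.card : ℝ) ^ ((5:ℝ) - δ/2) := by
    have : (A.card : ℝ) ^ 3 * ((A.card : ℝ) ^ ((1:ℝ) - δ) * A.card) =
        (A.card : ℝ) ^ ((5:ℝ) - δ) := by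
      have e1 : (5:ℝ) - δ = (4 : ℕ) + (1 - δ) := by push_cast; ring
      rw [e1, Real.rpow_add hm, Real.rpow_natCast]; ring
    rw [this]
    exact Real.rpow_le_rpow_of_exponent_le hm1 (by linarith)
  have mu : (A.card : ℝ) ≤ (n : ℝ) ^ ((7:ℝ)/4) := by
    refine hmS.trans ?_
    calc (n : ℝ) = (n : ℝ) ^ (1 : ℝ) := (Real.rpow_one _).symm
      _ ≤ _ := Real.rpow_le_rpow_of_exponent_le hS1 (by norm_num)
  have hβ : 0 ≤ (A.card : ℝ) ^ ((1:ℝ) - δ) := Real.rpow_nonneg hm.le _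
  have hu0 : 0 ≤ (n : ℝ) ^ ((7:ℝ)/4) := Real.rpow_nonneg hS.le _
  have hv0 : 0 ≤ (n : ℝ) ^ ((6:ℝ)/5) := Real.rpow_nonneg hS.le _
  have hw0 : 0 ≤ (A.card : ℝ) ^ ((3:ℝ)/5) := Real.rpow_nonneg hm.le _
  have hr0 : 0 ≤ (A.card : ℝ) ^ ((1:ℝ)/2) := Real.rpow_nonneg hm.le _
  have ht0 : 0 ≤ (q : ℝ) ^ (-(1:ℝ)/4) := Real.rpow_nonneg hqp.le _
  rw [m1, m2]
  generalize (n : ℝ) ^ ((7:ℝ)/4) = u at *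
  generalize (n : ℝ) ^ ((6:ℝ)/5) = v at *
  generalize (A.card : ℝ) ^ ((3:ℝ)/5) = w at *
  generalize (A.card : ℝ) ^ ((1:ℝ)/2) = r at *
  generalize (q : ℝ) ^ (-(1:ℝ)/4) = t at *
  generalize (A.card : ℝ) ^ ((1:ℝ) - δ) = β at *
  generalize (A.card : ℝ) ^ ((5:ℝ) - δ/2) = z at *
  obtain ⟨ψ, hψdef⟩ : ∃ ψ, ψ = max (max u (v * w)) (max (β * A.card) (u * r * t)) := ⟨_, rfl⟩
  have p1 : u ≤ ψ := by rw [hψdef]; exact le_max_of_le_left (le_max_left _ _)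
  have p2 : v * w ≤ ψ := by rw [hψdef]; exact le_max_of_le_left (le_max_right _ _)
  have p3 : β * A.card ≤ ψ := by rw [hψdef]; exact le_max_of_le_right (le_max_left _ _)
  have p4 : u * r * t ≤ ψ := by rw [hψdef]; exact le_max_of_le_right (le_max_right _ _)
  have hψ : 0 < ψ := by linarith
  have hE : ∀ a ∈ A, EE (sh A a) ≤ 16 * (3 * Real.log A.card * K) * (A.card * ψ) := by
    intro a _
    have := energy_bound he (S := n) (C := C) (β := β) (ψ := ψ) (M := A.card) hC hβ hψ hmS
      (by rw [← hu]; gcongr)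
      (by
        rw [← hv, ← hw, ← mul_pow]; gcongr)
      (by
        have e1 : (A.card : ℝ) ^ 2 = r ^ 4 := by
          rw [pow_one] at hr
          rw [← hr]; ring
        rw [hq, ← hu, e1]
        calc u ^ 4 * r ^ 4 = (q * t ^ 4) * (u ^ 4 * r ^ 4) := by rw [ht, one_mul]
          _ = q * (u * r * t) ^ 4 := by ring
          _ ≤ q * ψ ^ 4 := by gcongr)
      p3 (sh A a).card (sh A a) le_rfl (sh_zero A a) (sh_card A a)
      (le_trans (by exact_mod_cast sh_sum A a e) hSe) (sh_sub hsub a)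
    refine this.trans ?_
    have := sh_card A a
    gcongr
  have hT := T_bound A hE
  have hlog0 : 0 ≤ Real.log A.card := by linarith
  have hmψ : (A.card : ℝ) ≤ ψ := mu.trans p1
  have hfin : (A.card : ℝ) ^ 3 * ψ ≤ max (max (u * (A.card : ℝ) ^ 3) (v * ((A.card : ℝ) ^ 3 * w)))
      (max z (u * ((A.card : ℝ) ^ 3 * r) * t)) := by
    rw [hψdef, mul_max_of_nonneg _ _ (by positivity), mul_max_of_nonneg _ _ (by positivity),
      mul_max_of_nonneg _ _ (by positivity)]
    refine max_le_max (max_le_max (le_of_eq (by ring)) (le_of_eq (by ring)))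
      (max_le_max m3 (le_of_eq (by ring)))
  refine hT.trans ?_
  calc (A.card : ℝ) ^ 2 * (4 * (A.card : ℝ) ^ 2 +
        16 * (3 * Real.log A.card * K) * (A.card * ψ))
      = 4 * ((A.card : ℝ) ^ 3 * A.card) + 48 * K * Real.log A.card * ((A.card : ℝ) ^ 3 * ψ) := by
        ring
    _ ≤ (6 * Real.log A.card) * ((A.card : ℝ) ^ 3 * ψ) +
        48 * K * Real.log A.card * ((A.card : ℝ) ^ 3 * ψ) := by gcongr
    _ = (6 + 48 * K) * Real.log A.card * ((A.card : ℝ) ^ 3 * ψ) := by ring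
    _ ≤ _ := by gcongr

theorem stmt6 : ∀ C δ : ℝ, 0 < C → 0 < δ → ∃ C' : ℝ, 0 < C' ∧
    ∀ (F : Type) [Field F] [Fintype F] (q : ℕ), IsPrimePow q → Fintype.card F = q →
    ∀ A : Finset F, 2 ≤ A.card →
    subfieldCond A C ((A.card : ℝ) ^ ((1:ℝ) - δ)) →
    (collinearTriples A A : ℝ) ≤
      C' * Real.log (A.card : ℝ) *
        max (max (((A + A).card : ℝ) ^ ((7:ℝ)/4) * (A.card : ℝ) ^ (3:ℕ))
            (((A + A).card : ℝ) ^ ((6:ℝ)/5) * (A.card : ℝ) ^ ((18:ℝ)/5)))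
          (max ((A.card : ℝ) ^ ((5:ℝ) - δ/2))
            (((A + A).card : ℝ) ^ ((7:ℝ)/4) * (A.card : ℝ) ^ ((7:ℝ)/2) * (q : ℝ) ^ (-(1:ℝ)/4))) ∧
    (collinearTriples A A : ℝ) ≤
      C' * Real.log (A.card : ℝ) *
        max (max (((A - A).card : ℝ) ^ ((7:ℝ)/4) * (A.card : ℝ) ^ (3:ℕ))
            (((A - A).card : ℝ) ^ ((6:ℝ)/5) * (A.card : ℝ) ^ ((18:ℝ)/5)))
          (max ((A.card : ℝ) ^ ((5:ℝ) - δ/2))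
            (((A - A).card : ℝ) ^ ((7:ℝ)/4) * (A.card : ℝ) ^ ((7:ℝ)/2) * (q : ℝ) ^ (-(1:ℝ)/4))) := by
  intro C δ hC hδ
  refine ⟨6 + 48 * (2 * (2 ^ 46 * (1 + C ^ 2))), by positivity, ?_⟩
  intro F _ _ q _ hq A hA hsub
  have i1 : A.image ((1 : F) * ·) = A := by ext v; simp
  have i2 : A.image ((-1 : F) * ·) = -A := by
    ext v
    simp [Finset.mem_neg, neg_eq_iff_eq_neg]
  have e1 : (A + A.image ((1 : F) * ·)).card = (A + A).card := by rw [i1]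
  have e2 : (A + A.image ((-1 : F) * ·)).card = (A - A).card := by rw [i2, sub_eq_add_neg]
  exact ⟨final_e hC hδ (Or.inl rfl) hA hsub e1 hq, final_e hC hδ (Or.inr rfl) hA hsub e2 hq⟩

end STP
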